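/- The set of homeomorphisms f ∈ Homeo₀(T²) whose rotation set is stable (with respect to C⁰-small perturbations within Homeo₀(T²)) is open and dense in Homeo₀(T²) for the uniform C⁰ topology. -/

import Mathlib

noncomputable section

open Metric Set Filter Topology MeasureTheory Pointwise

/-- The plane `ℝ²` with the Euclidean metric. -/
abbrev R2 : Type := EuclideanSpace ℝ (Fin 2)

/-- The integer lattice `ℤ² ⊂ ℝ²`. -/
def intLattice : AddSubgroup R2 where
  carrier := {v : R2 | ∀ i, ∃ n : ℤ, v i = (n : ℝ)}
  add_mem' := by
    intro a b ha hb i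
    obtain ⟨m, hm⟩ := ha i
    obtain ⟨n, hn⟩ := hb i
    exact ⟨m + n, by push_cast; rw [← hm, ← hn]; rfl⟩
  zero_mem' := fun i => ⟨0, by simp⟩
  neg_mem' := by
    intro a ha i
    obtain ⟨m, hm⟩ := ha i
    exact ⟨-m, by push_cast; rw [← hm]; rfl⟩

/-- The torus `T² = ℝ²/ℤ²`, with the quotient (Euclidean) metric. -/
abbrev T2 : Type := R2 ⧸ intLattice

/-- The covering projection `π : ℝ² → T²`. -/
def pr : R2 → T2 := QuotientAddGroup.mk

instance : MeasurableSpace T2 := borel T2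
instance : BorelSpace T2 := ⟨rfl⟩

/-- A fundamental domain `[0,1)²` for the lattice action. -/
def fundDomain : Set R2 := {x : R2 | ∀ i, x i ∈ Set.Ico (0 : ℝ) 1}

/-- Lebesgue (Haar) probability measure on the torus `T²`. -/
def lebT2 : Measure T2 := Measure.map pr (volume.restrict fundDomain)

/-- `F : ℝ² → ℝ²` is a lift of `f : T² → T²` if `π ∘ F = f ∘ π` and
`F (x + w) = F x + w` for every lattice vector `w ∈ ℤ²`. -/
structure IsLift (f : T2 ≃ₜ T2) (F : R2 ≃ₜ R2) : Prop where
  proj : ∀ x : R2, pr (F x) = f (pr x)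
  equivariant : ∀ x : R2, ∀ w ∈ intLattice, F (x + w) = F x + w

/-- `Homeo₀(T²)`: homeomorphisms of the torus isotopic to the identity,
characterized as those admitting a lift commuting with integer translations. -/
def Homeo0 : Set (T2 ≃ₜ T2) := {f | ∃ F : R2 ≃ₜ R2, IsLift f F}

/-- `Homeo_{0,λ}(T²)`: elements of `Homeo₀(T²)` preserving Lebesgue measure. -/
def Homeo0Leb : Set (T2 ≃ₜ T2) :=
  {f | f ∈ Homeo0 ∧ MeasurePreserving f lebT2 lebT2}

/-- The uniform `C⁰` distance `d_{C⁰}(f,g) = sup_x d(f(x), g(x))` on torus maps. -/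
def dC0 (f g : T2 ≃ₜ T2) : ℝ := ⨆ x : T2, dist (f x) (g x)

/-- The uniform distance `sup_{x ∈ ℝ²} ‖F(x) − G(x)‖` between maps of the plane. -/
def supDist (F G : R2 → R2) : ℝ := ⨆ x : R2, dist (F x) (G x)

/-- The rotation set `ρ(F̃)` of a lift: all limits `(F̃^{n_k}(z_k) − z_k)/n_k`. -/
def rotSet (F : R2 ≃ₜ R2) : Set R2 :=
  {v | ∃ (z : ℕ → R2) (n : ℕ → ℕ), Tendsto n atTop atTop ∧
    Tendsto (fun k => (n k : ℝ)⁻¹ • ((⇑F)^[n k] (z k) - z k)) atTop (𝓝 v)}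

/-- The rotation set of `f`, with fixed lift `F`, is `δ`-upper-stable in `H`. -/
def UpperStable (H : Set (T2 ≃ₜ T2)) (F : R2 ≃ₜ R2) (δ : ℝ) : Prop :=
  ∀ g ∈ H, ∀ G : R2 ≃ₜ R2, IsLift g G → supDist (⇑F) (⇑G) < δ →
    rotSet G ⊆ rotSet F

/-- The rotation set of `f`, with fixed lift `F`, is `δ`-stable in `H`. -/
def StableRS (H : Set (T2 ≃ₜ T2)) (F : R2 ≃ₜ R2) (δ : ℝ) : Prop :=
  ∀ g ∈ H, ∀ G : R2 ≃ₜ R2, IsLift g G → supDist (⇑F) (⇑G) < δ →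
    rotSet G = rotSet F

/-- `f` has a stable rotation set in `H`. -/
def HasStableRotSet (H : Set (T2 ≃ₜ T2)) (f : T2 ≃ₜ T2) : Prop :=
  ∃ F : R2 ≃ₜ R2, IsLift f F ∧ ∃ δ > 0, StableRS H F δ

/-- `S` is open in `H` for the uniform `C⁰` topology. -/
def OpenIn (H S : Set (T2 ≃ₜ T2)) : Prop :=
  ∀ f ∈ S ∩ H, ∃ δ > 0, ∀ g ∈ H, dC0 f g < δ → g ∈ S

/-- `S` is dense in `H` for the uniform `C⁰` topology. -/
def DenseIn (H S : Set (T2 ≃ₜ T2)) : Prop :=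
  ∀ f ∈ H, ∀ ε > 0, ∃ g ∈ S ∩ H, dC0 f g < ε

/-- `(x_i)_{0 ≤ i ≤ n}` is a finite `ε`-pseudo-orbit of `F`. -/
def IsPseudoOrbitUpTo (F : R2 → R2) (ε : ℝ) (x : ℕ → R2) (n : ℕ) : Prop :=
  ∀ i < n, dist (F (x i)) (x (i + 1)) < ε

/-- `(x_i)_{i ∈ ℕ}` is an infinite `ε`-pseudo-orbit of `F`. -/
def IsPseudoOrbit (F : R2 → R2) (ε : ℝ) (x : ℕ → R2) : Prop :=
  ∀ i : ℕ, dist (F (x i)) (x (i + 1)) < ε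

/-- The `ε`-pseudo-rotation set `ρ_ε(F̃)`. -/
def pseudoRotSet (F : R2 → R2) (ε : ℝ) : Set R2 :=
  {v | ∃ (n : ℕ → ℕ) (x : ℕ → ℕ → R2), Tendsto n atTop atTop ∧
    (∀ k, IsPseudoOrbitUpTo F ε (x k) (n k)) ∧
    Tendsto (fun k => (n k : ℝ)⁻¹ • (x k (n k) - x k 0)) atTop (𝓝 v)}

/-- The oscillation `osc(f) = sup_{x,y} ‖(F(x) − x) − (F(y) − y)‖` of a lift. -/
def osc (F : R2 → R2) : ℝ := ⨆ p : R2 × R2, ‖(F p.1 - p.1) - (F p.2 - p.2)‖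

/-- `f` has the shadowing property. -/
def Shadowing (f : T2 ≃ₜ T2) : Prop :=
  ∀ ε > 0, ∃ δ > 0, ∀ x : ℕ → T2, (∀ i, dist (f (x i)) (x (i + 1)) < δ) →
    ∃ z : T2, ∀ i, dist ((⇑f)^[i] z) (x i) < ε

/-- `v ∈ ℚ² ⊂ ℝ²`. -/
def IsRationalPoint (v : R2) : Prop := ∀ i, ∃ q : ℚ, v i = (q : ℝ)



def plm (a b c d u : ℝ) : ℝ :=
  c / a * min u a + (d - c) / (b - a) * (max a (min u b) - a) + (1 - d) / (1 - b) * (max u b - b)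

structure PlOk (a b c d : ℝ) : Prop where
  h1 : 0 < a
  h2 : a < b
  h3 : b < 1
  h4 : 0 < c
  h5 : c < d
  h6 : d < 1

lemma PlOk.symm {a b c d : ℝ} (h : PlOk a b c d) : PlOk c d a b :=
  ⟨h.h4, h.h5, h.h6, h.h1, h.h2, h.h3⟩

lemma plm_low {a b c d u : ℝ} (h : PlOk a b c d) (hu : u ≤ a) : plm a b c d u = c / a * u := by
  obtain ⟨h1, h2, h3, h4, h5, h6⟩ := h
  have : u ≤ b := by linarith
  simp [plm, min_eq_left hu, min_eq_left this, max_eq_left hu, max_eq_right this]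

lemma plm_mid {a b c d u : ℝ} (h : PlOk a b c d) (hu : a ≤ u) (hu' : u ≤ b) :
    plm a b c d u = c + (d - c) / (b - a) * (u - a) := by
  obtain ⟨h1, h2, h3, h4, h5, h6⟩ := h
  simp [plm, min_eq_right hu, min_eq_left hu', max_eq_right hu, max_eq_right hu', h1.ne']

lemma plm_high {a b c d u : ℝ} (h : PlOk a b c d) (hu : b ≤ u) :
    plm a b c d u = d + (1 - d) / (1 - b) * (u - b) := by
  obtain ⟨h1, h2, h3, h4, h5, h6⟩ := h
  have : a ≤ u := by linarith
  have h7 : b - a ≠ 0 := by linarith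
  simp [plm, min_eq_right hu, min_eq_right this, max_eq_right h2.le, max_eq_left hu, h1.ne', h7]

lemma plm_low_le {a b c d u : ℝ} (h : PlOk a b c d) (hu : u ≤ a) : plm a b c d u ≤ c := by
  rw [plm_low h hu, div_mul_eq_mul_div, div_le_iff₀ h.h1]
  exact mul_le_mul_of_nonneg_left hu h.h4.le

lemma plm_mid_ge {a b c d u : ℝ} (h : PlOk a b c d) (hu : a ≤ u) (hu' : u ≤ b) :
    c ≤ plm a b c d u := by
  rw [plm_mid h hu hu']
  have : 0 ≤ (d - c) / (b - a) * (u - a) :=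
    mul_nonneg (div_nonneg (by linarith [h.h5]) (by linarith [h.h2])) (by linarith)
  linarith

lemma plm_mid_le {a b c d u : ℝ} (h : PlOk a b c d) (hu : a ≤ u) (hu' : u ≤ b) :
    plm a b c d u ≤ d := by
  rw [plm_mid h hu hu']
  have : (d - c) / (b - a) * (u - a) ≤ d - c := by
    rw [div_mul_eq_mul_div, div_le_iff₀ (by linarith [h.h2])]
    exact mul_le_mul_of_nonneg_left (by linarith) (by linarith [h.h5])
  linarith

lemma plm_high_ge {a b c d u : ℝ} (h : PlOk a b c d) (hu : b ≤ u) : d ≤ plm a b c d u := by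
  rw [plm_high h hu]
  have : 0 ≤ (1 - d) / (1 - b) * (u - b) :=
    mul_nonneg (div_nonneg (by linarith [h.h6]) (by linarith [h.h3])) (by linarith)
  linarith

lemma plm_inv {a b c d u : ℝ} (h : PlOk a b c d) : plm c d a b (plm a b c d u) = u := by
  have h1 := h.h1
  have h2 := h.h2
  have h3 := h.h3
  have h4 := h.h4
  have h5 := h.h5
  have h6 := h.h6
  have e1 : b - a ≠ 0 := by linarith
  have e2 : d - c ≠ 0 := by linarith
  have e3 : 1 - b ≠ 0 := by linarith
  have e4 : 1 - d ≠ 0 := by linarith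
  rcases le_total u a with hu | hu
  · rw [plm_low h.symm (plm_low_le h hu), plm_low h hu]
    field_simp
  rcases le_total u b with hu' | hu'
  · rw [plm_mid h.symm (plm_mid_ge h hu hu') (plm_mid_le h hu hu'), plm_mid h hu hu']
    field_simp
    ring
  · rw [plm_high h.symm (plm_high_ge h hu'), plm_high h hu']
    field_simp
    ring

lemma plm_zero {a b c d : ℝ} (h : PlOk a b c d) : plm a b c d 0 = 0 := by
  rw [plm_low h h.h1.le]; simp

lemma plm_one {a b c d : ℝ} (h : PlOk a b c d) : plm a b c d 1 = 1 := by
  rw [plm_high h h.h3.le]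
  have e3 : 1 - b ≠ 0 := by linarith [h.h3]
  field_simp
  ring

lemma plm_nonneg {a b c d u : ℝ} (h : PlOk a b c d) (hu : 0 ≤ u) : 0 ≤ plm a b c d u := by
  rcases le_total u a with hua | hua
  · rw [plm_low h hua]
    exact mul_nonneg (div_nonneg h.h4.le h.h1.le) hu
  rcases le_total u b with hu' | hu'
  · exact h.h4.le.trans (plm_mid_ge h hua hu')
  · exact (h.h4.trans h.h5).le.trans (plm_high_ge h hu')

lemma plm_le_one {a b c d u : ℝ} (h : PlOk a b c d) (hu : u ≤ 1) : plm a b c d u ≤ 1 := by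
  rcases le_total u a with hua | hua
  · exact (plm_low_le h hua).trans (h.h5.trans h.h6).le
  rcases le_total u b with hu' | hu'
  · exact (plm_mid_le h hua hu').trans h.h6.le
  · rw [plm_high h hu']
    have : (1 - d) / (1 - b) * (u - b) ≤ 1 - d := by
      rw [div_mul_eq_mul_div, div_le_iff₀ (by linarith [h.h3])]
      exact mul_le_mul_of_nonneg_left (by linarith) (by linarith [h.h6])
    linarith

def plp (a b c d u : ℝ) : ℝ := (⌊u⌋ : ℝ) + plm a b c d (Int.fract u)

lemma plp_cell {a b c d u : ℝ} (h : PlOk a b c d) (k : ℤ) (h1 : (k : ℝ) ≤ u)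
    (h2 : u ≤ k + 1) : plp a b c d u = k + plm a b c d (u - k) := by
  rcases h2.lt_or_eq with h2 | h2
  · have : ⌊u⌋ = k := Int.floor_eq_iff.2 ⟨h1, h2⟩
    rw [plp, Int.fract, this]
  · subst h2
    have : ⌊(k : ℝ) + 1⌋ = k + 1 := by simp
    rw [plp, Int.fract, this]
    push_cast
    simp [plm_zero h, plm_one h]

lemma plp_mem {a b c d u : ℝ} (h : PlOk a b c d) (k : ℤ) (h1 : (k : ℝ) ≤ u)
    (h2 : u ≤ k + 1) : (k : ℝ) ≤ plp a b c d u ∧ plp a b c d u ≤ k + 1 := by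
  rw [plp_cell h k h1 h2]
  have := plm_nonneg h (u := u - k) (by linarith)
  have := plm_le_one h (u := u - k) (by linarith)
  constructor <;> linarith

lemma plp_inv {a b c d u : ℝ} (h : PlOk a b c d) : plp c d a b (plp a b c d u) = u := by
  have h1 := Int.floor_le u
  have h2 := (Int.lt_floor_add_one u).le
  obtain ⟨h3, h4⟩ := plp_mem h _ h1 h2
  rw [plp_cell h.symm _ h3 h4, plp_cell h _ h1 h2]
  rw [add_sub_cancel_left, plm_inv h]
  ring

lemma plp_add_int (a b c d u : ℝ) (k : ℤ) : plp a b c d (u + k) = plp a b c d u + k := by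
  simp only [plp, Int.floor_add_intCast, Int.fract_add_intCast]
  push_cast; ring

lemma plp_cont {X : Type*} [TopologicalSpace X] {a b c d u : X → ℝ}
    (h : ∀ x, PlOk (a x) (b x) (c x) (d x)) (ha : Continuous a) (hb : Continuous b)
    (hc : Continuous c) (hd : Continuous d) (hu : Continuous u) :
    Continuous fun x => plp (a x) (b x) (c x) (d x) (u x) := by
  have e : (fun x => plp (a x) (b x) (c x) (d x) (u x)) = fun x =>
      u x + (fun (x : X) (t : ℝ) => plm (a x) (b x) (c x) (d x) t - t) x (Int.fract (u x)) := by
    funext x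
    simp only [plp]
    have := Int.floor_add_fract (u x)
    linarith
  rw [e]
  refine hu.add (ContinuousOn.comp_fract
    (f := fun (x : X) (t : ℝ) => plm (a x) (b x) (c x) (d x) t - t)
    (Continuous.continuousOn ?_) hu ?_)
  · have h1 : ∀ p : X × ℝ, a p.1 ≠ 0 := fun p => (h p.1).h1.ne'
    have h2 : ∀ p : X × ℝ, b p.1 - a p.1 ≠ 0 := fun p => by linarith [(h p.1).h2]
    have h3 : ∀ p : X × ℝ, 1 - b p.1 ≠ 0 := fun p => by linarith [(h p.1).h3]
    simp only [Function.uncurry_def, plm]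
    fun_prop (disch := assumption)
  · intro x
    simp [plm_zero (h x), plm_one (h x)]

/-- fibred homeomorphism over the first coordinate -/
def fibH (a b c d : ℝ → ℝ) (h : ∀ x, PlOk (a x) (b x) (c x) (d x)) (ha : Continuous a)
    (hb : Continuous b) (hc : Continuous c) (hd : Continuous d) : ℝ × ℝ ≃ₜ ℝ × ℝ where
  toFun p := (p.1, plp (a p.1) (b p.1) (c p.1) (d p.1) p.2)
  invFun p := (p.1, plp (c p.1) (d p.1) (a p.1) (b p.1) p.2)
  left_inv p := by simp [plp_inv (h p.1)]
  right_inv p := by simp [plp_inv (h p.1).symm]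
  continuous_toFun := continuous_fst.prodMk
    (plp_cont (fun p : ℝ × ℝ => h p.1) (ha.comp continuous_fst) (hb.comp continuous_fst)
      (hc.comp continuous_fst) (hd.comp continuous_fst) continuous_snd)
  continuous_invFun := continuous_fst.prodMk
    (plp_cont (fun p : ℝ × ℝ => (h p.1).symm) (hc.comp continuous_fst) (hd.comp continuous_fst)
      (ha.comp continuous_fst) (hb.comp continuous_fst) continuous_snd)

/-- the subpath lemma -/
lemma subpath_aux {g : ℝ → ℝ} (hg : Continuous g) {u v α β : ℝ} (huv : u ≤ v) (hαβ : α ≤ β)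
    (hu : g u ≤ α) (hv : β ≤ g v) :
    ∃ u' v', u ≤ u' ∧ u' ≤ v' ∧ v' ≤ v ∧ g u' = α ∧ g v' = β ∧
      ∀ t, u' ≤ t → t ≤ v' → α ≤ g t ∧ g t ≤ β := by
  have hA : IsCompact (Icc u v ∩ g ⁻¹' Iic α) :=
    isCompact_Icc.inter_right (isClosed_Iic.preimage hg)
  obtain ⟨u', hu', hmax⟩ := hA.exists_isGreatest ⟨u, ⟨le_refl _, huv⟩, hu⟩
  have hgu' : g u' = α := by
    have h1 : α ∈ Icc (g u') (g v) := ⟨hu'.2, hαβ.trans hv⟩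
    obtain ⟨t, ht, hte⟩ := intermediate_value_Icc hu'.1.2 hg.continuousOn h1
    have h2 : t ≤ u' := hmax ⟨⟨hu'.1.1.trans ht.1, ht.2⟩, hte.le⟩
    have : t = u' := le_antisymm h2 ht.1
    rw [← this, hte]
  have hB : IsCompact (Icc u' v ∩ g ⁻¹' Ici β) :=
    isCompact_Icc.inter_right (isClosed_Ici.preimage hg)
  obtain ⟨v', hv', hmin⟩ := hB.exists_isLeast ⟨v, ⟨hu'.1.2, le_refl _⟩, hv⟩
  have hgv' : g v' = β := by
    have h1 : β ∈ Icc (g u') (g v') := ⟨hgu'.le.trans hαβ, hv'.2⟩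
    obtain ⟨t, ht, hte⟩ := intermediate_value_Icc hv'.1.1 hg.continuousOn h1
    have h2 : v' ≤ t := hmin ⟨⟨ht.1, ht.2.trans hv'.1.2⟩, hte.ge⟩
    have : t = v' := le_antisymm ht.2 h2
    rw [← this, hte]
  refine ⟨u', v', hu'.1.1, hv'.1.1, hv'.1.2, hgu', hgv', fun t h1 h2 => ⟨?_, ?_⟩⟩
  · by_contra! hlt
    have h3 : t ≤ u' := hmax ⟨⟨hu'.1.1.trans h1, h2.trans hv'.1.2⟩, hlt.le⟩
    have : t = u' := le_antisymm h3 h1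
    subst this; linarith
  · by_contra! hlt
    have h3 : v' ≤ t := hmin ⟨⟨h1, h2.trans hv'.1.2⟩, hlt.le⟩
    have : t = v' := le_antisymm h2 h3
    subst this; linarith

lemma subpath_aux2 {g : ℝ → ℝ} (hg : Continuous g) {u v α β : ℝ} (hαβ : α ≤ β)
    (hu : g u ≤ α) (hv : β ≤ g v) :
    ∃ u' v', u' ∈ uIcc u v ∧ v' ∈ uIcc u v ∧ g u' = α ∧ g v' = β ∧
      ∀ t ∈ uIcc u' v', α ≤ g t ∧ g t ≤ β := by
  rcases le_total u v with huv | huv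
  · obtain ⟨u', v', h1, h2, h3, h4, h5, h6⟩ := subpath_aux hg huv hαβ hu hv
    refine ⟨u', v', ?_, ?_, h4, h5, ?_⟩
    · rw [uIcc_of_le huv]; exact ⟨h1, h2.trans h3⟩
    · rw [uIcc_of_le huv]; exact ⟨h1.trans h2, h3⟩
    · rw [uIcc_of_le h2]; exact fun t ht => h6 t ht.1 ht.2
  · obtain ⟨u', v', h1, h2, h3, h4, h5, h6⟩ := subpath_aux (g := fun t => g (-t))
      (hg.comp continuous_neg) (neg_le_neg huv) hαβ (by simpa using hu) (by simpa using hv)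
    refine ⟨-u', -v', ?_, ?_, h4, h5, ?_⟩
    · rw [uIcc_of_ge huv]; constructor <;> linarith
    · rw [uIcc_of_ge huv]; constructor <;> linarith
    · rw [uIcc_of_ge (neg_le_neg h2)]
      intro t ht
      have := h6 (-t) (by linarith [ht.2]) (by linarith [ht.1])
      simpa using this

lemma subpath {g : ℝ → ℝ} (hg : Continuous g) {u v α β : ℝ}
    (hu : g u ≤ α) (hu2 : g u ≤ β) (hv : β ≤ g v) (hv2 : α ≤ g v) :
    ∃ u' v', u' ∈ uIcc u v ∧ v' ∈ uIcc u v ∧ g u' = α ∧ g v' = β ∧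
      ∀ t ∈ uIcc u' v', g t ∈ uIcc α β := by
  rcases le_total α β with h | h
  · obtain ⟨u', v', h1, h2, h3, h4, h5⟩ := subpath_aux2 hg h hu hv
    exact ⟨u', v', h1, h2, h3, h4, fun t ht => by rw [uIcc_of_le h]; exact h5 t ht⟩
  · obtain ⟨u', v', h1, h2, h3, h4, h5⟩ := subpath_aux2 hg h hu2 hv2
    exact ⟨v', u', h2, h1, h4, h3, fun t ht => by
      rw [uIcc_of_ge h]; exact h5 t (by rwa [uIcc_comm])⟩

def cellC (k : ℤ × ℤ) : Set (ℝ × ℝ) :=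
  {p | (k.1 : ℝ) ≤ p.1 ∧ p.1 ≤ k.1 + 1 ∧ (k.2 : ℝ) ≤ p.2 ∧ p.2 ≤ k.2 + 1}

def cellO (k : ℤ × ℤ) : Set (ℝ × ℝ) :=
  {p | (k.1 : ℝ) < p.1 ∧ p.1 < k.1 + 1 ∧ (k.2 : ℝ) < p.2 ∧ p.2 < k.2 + 1}

def Per (m : ℕ) (F : ℝ × ℝ → ℝ × ℝ) : Prop :=
  ∀ (p : ℝ × ℝ) (i j : ℤ), F (p.1 + m * i, p.2 + m * j) = ((F p).1 + m * i, (F p).2 + m * j)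

def Arrow (F : ℝ × ℝ → ℝ × ℝ) (k l : ℤ × ℤ) : Prop := ∃ x ∈ cellO k, F x ∈ cellO l

def Gen (F : ℝ × ℝ → ℝ × ℝ) : Prop :=
  ∀ k l, (∃ x ∈ cellC k, F x ∈ cellC l) → Arrow F k l

/-- the combined in-cell homeomorphism -/
def psi (θ c : ℝ → ℝ) (η τ : ℝ) (hθ : ∀ x, PlOk η (1 - η) (θ x - τ) (θ x + τ))
    (hc : ∀ x, PlOk η (1 - η) (c x - τ) (c x + τ)) (cθ : Continuous θ) (cc : Continuous c) :
    ℝ × ℝ ≃ₜ ℝ × ℝ :=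
  (((Homeomorph.prodComm ℝ ℝ).trans
    (fibH (fun y => c y - τ) (fun y => c y + τ) (fun _ => η) (fun _ => 1 - η)
      (fun y => (hc y).symm) (by fun_prop) (by fun_prop) (by fun_prop) (by fun_prop))).trans
    (Homeomorph.prodComm ℝ ℝ)).trans
    (fibH (fun _ => η) (fun _ => 1 - η) (fun y => θ y - τ) (fun y => θ y + τ)
      hθ (by fun_prop) (by fun_prop) (by fun_prop) (by fun_prop))

section psi
variable {θ c : ℝ → ℝ} {η τ : ℝ} (hθ : ∀ x, PlOk η (1 - η) (θ x - τ) (θ x + τ))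
    (hc : ∀ x, PlOk η (1 - η) (c x - τ) (c x + τ)) (cθ : Continuous θ) (cc : Continuous c)

lemma psi_apply (p : ℝ × ℝ) : psi θ c η τ hθ hc cθ cc p =
    (plp (c p.2 - τ) (c p.2 + τ) η (1 - η) p.1,
      plp η (1 - η) (θ (plp (c p.2 - τ) (c p.2 + τ) η (1 - η) p.1) - τ)
        (θ (plp (c p.2 - τ) (c p.2 + τ) η (1 - η) p.1) + τ) p.2) := rfl

lemma psi_cell {k : ℤ × ℤ} {p : ℝ × ℝ} (hp : p ∈ cellC k) :
    psi θ c η τ hθ hc cθ cc p ∈ cellC k := by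
  rw [psi_apply]
  obtain ⟨h1, h2, h3, h4⟩ := hp
  obtain ⟨h5, h6⟩ := plp_mem (hc p.2).symm _ h1 h2
  obtain ⟨h7, h8⟩ := plp_mem (hθ (plp (c p.2 - τ) (c p.2 + τ) η (1 - η) p.1)) _ h3 h4
  exact ⟨h5, h6, h7, h8⟩

lemma psi_per {m : ℕ} (pθ : ∀ (x : ℝ) (i : ℤ), θ (x + m * i) = θ x)
    (pc : ∀ (x : ℝ) (i : ℤ), c (x + m * i) = c x) : Per m (psi θ c η τ hθ hc cθ cc) := by
  intro p i j
  have e : ∀ (a b c d u : ℝ) (i : ℤ), plp a b c d (u + m * i) = plp a b c d u + m * i := by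
    intro a b c d u i
    have := plp_add_int a b c d u ((m : ℤ) * i)
    push_cast at this
    exact this
  simp only [psi_apply, pc, e, pθ]

end psi

lemma mem_cell (p : ℝ × ℝ) : p ∈ cellC (⌊p.1⌋, ⌊p.2⌋) :=
  ⟨Int.floor_le _, (Int.lt_floor_add_one _).le, Int.floor_le _, (Int.lt_floor_add_one _).le⟩

lemma cell_dist {k : ℤ × ℤ} {p q : ℝ × ℝ} (hp : p ∈ cellC k) (hq : q ∈ cellC k) :
    dist p q ≤ 1 := by
  obtain ⟨h1, h2, h3, h4⟩ := hp
  obtain ⟨h5, h6, h7, h8⟩ := hq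
  rw [Prod.dist_eq]
  refine max_le ?_ ?_ <;> rw [Real.dist_eq, abs_le] <;> constructor <;> linarith

structure Good (F : ℝ × ℝ → ℝ × ℝ) (θ c : ℝ → ℝ) (η τ δ : ℝ) (k l : ℤ × ℤ) (b α β : ℝ) :
    Prop where
  p1 : k.1 + η ≤ α
  p1' : α ≤ k.1 + (1 - η)
  p1b : k.1 + η ≤ β
  p1b' : β ≤ k.1 + (1 - η)
  p2 : ∀ y, |y - b| < η → l.2 + η ≤ y ∧ y ≤ l.2 + (1 - η) ∧ c y = c b
  p3 : ∀ x ∈ uIcc α β, ∀ y, |y - (k.2 + θ x)| ≤ τ → ∀ q, dist q (F (x, y)) < δ →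
    l.1 < q.1 ∧ q.1 < l.1 + 1 ∧ |q.2 - b| < η
  p4 : ∀ y, |y - (k.2 + θ α)| ≤ τ → ∀ q, dist q (F (α, y)) < δ → q.1 ≤ l.1 + (c b - τ)
  p5 : ∀ y, |y - (k.2 + θ β)| ≤ τ → ∀ q, dist q (F (β, y)) < δ → l.1 + (c b + τ) ≤ q.1

structure Crossing (c : ℝ → ℝ) (η τ : ℝ) (l : ℤ × ℤ) (b : ℝ) (γ : ℝ → ℝ × ℝ) (u v : ℝ) :
    Prop where
  mem : ∀ t ∈ uIcc u v, l.1 < (γ t).1 ∧ (γ t).1 < l.1 + 1 ∧ |(γ t).2 - b| < η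
  left : (γ u).1 ≤ l.1 + (c b - τ)
  right : l.1 + (c b + τ) ≤ (γ v).1

lemma step {F : ℝ × ℝ → ℝ × ℝ} {θ c : ℝ → ℝ} {η τ δ : ℝ}
    (hθ : ∀ x, PlOk η (1 - η) (θ x - τ) (θ x + τ))
    (hc : ∀ x, PlOk η (1 - η) (c x - τ) (c x + τ)) (cθ : Continuous θ) (cc : Continuous c)
    {k l n : ℤ × ℤ} {b α β b' α' β' : ℝ} (G1 : Good F θ c η τ δ k l b α β)
    (G2 : Good F θ c η τ δ l n b' α' β') {H : ℝ × ℝ → ℝ × ℝ}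
    (hH : ∀ x, dist (H x) (F (psi θ c η τ hθ hc cθ cc x)) < δ)
    {γ : ℝ → ℝ × ℝ} (hγ : Continuous γ) {u v : ℝ} (hcr : Crossing c η τ l b γ u v) :
    ∃ u' v', u' ∈ uIcc u v ∧ v' ∈ uIcc u v ∧ Crossing c η τ n b' (H ∘ γ) u' v' := by
  set g : ℝ → ℝ := fun t => plp (c (γ t).2 - τ) (c (γ t).2 + τ) η (1 - η) (γ t).1 with hgdef
  have hg : Continuous g := plp_cont (fun t => (hc (γ t).2).symm) (by fun_prop) (by fun_prop)
    (by fun_prop) (by fun_prop) (by fun_prop)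
  have hgt : ∀ t ∈ uIcc u v, g t = l.1 + plm (c b - τ) (c b + τ) η (1 - η) ((γ t).1 - l.1) := by
    intro t ht
    obtain ⟨h1, h2, h3⟩ := hcr.mem t ht
    simp only [hgdef, (G1.p2 _ h3).2.2]
    exact plp_cell (hc b).symm _ h1.le h2.le
  have hgu : g u ≤ l.1 + η := by
    rw [hgt u left_mem_uIcc]
    have := plm_low_le (hc b).symm (u := (γ u).1 - l.1) (by linarith [hcr.left])
    linarith
  have hgv : l.1 + (1 - η) ≤ g v := by
    rw [hgt v right_mem_uIcc]
    have := plm_high_ge (hc b).symm (u := (γ v).1 - l.1) (by linarith [hcr.right])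
    linarith
  obtain ⟨u', v', hu', hv', hα, hβ, hbt⟩ := subpath hg (hgu.trans G2.p1) (hgu.trans G2.p1b)
    (G2.p1b'.trans hgv) (G2.p1'.trans hgv)
  have hsub : uIcc u' v' ⊆ uIcc u v := uIcc_subset_uIcc hu' hv'
  have key : ∀ t ∈ uIcc u v, ∃ y, psi θ c η τ hθ hc cθ cc (γ t) = (g t, y) ∧
      |y - (l.2 + θ (g t))| ≤ τ := by
    intro t ht
    refine ⟨_, psi_apply hθ hc cθ cc (γ t), ?_⟩
    obtain ⟨h1, h2, h3⟩ := hcr.mem t ht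
    obtain ⟨h4, h5, -⟩ := G1.p2 _ h3
    have hη := (hθ 0).h1
    change |plp η (1 - η) (θ (g t) - τ) (θ (g t) + τ) (γ t).2 - (l.2 + θ (g t))| ≤ τ
    rw [plp_cell (hθ (g t)) l.2 (by linarith) (by linarith)]
    have h6 := plm_mid_ge (hθ (g t)) (u := (γ t).2 - l.2) (by linarith) (by linarith)
    have h7 := plm_mid_le (hθ (g t)) (u := (γ t).2 - l.2) (by linarith) (by linarith)
    rw [abs_le]; constructor <;> linarith
  refine ⟨u', v', hu', hv', ?_, ?_, ?_⟩
  · intro t ht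
    obtain ⟨y, e, hy⟩ := key t (hsub ht)
    have := hH (γ t)
    rw [e] at this
    exact G2.p3 _ (hbt t ht) y hy _ this
  · obtain ⟨y, e, hy⟩ := key u' hu'
    have := hH (γ u')
    rw [e] at this
    rw [hα] at hy this
    exact G2.p4 y hy _ this
  · obtain ⟨y, e, hy⟩ := key v' hv'
    have := hH (γ v')
    rw [e] at this
    rw [hβ] at hy this
    exact G2.p5 y hy _ this

lemma realize_aux {F : ℝ × ℝ → ℝ × ℝ} {θ c : ℝ → ℝ} {η τ δ : ℝ}
    (hθ : ∀ x, PlOk η (1 - η) (θ x - τ) (θ x + τ))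
    (hc : ∀ x, PlOk η (1 - η) (c x - τ) (c x + τ)) (cθ : Continuous θ) (cc : Continuous c)
    (hG : ∀ k l, Arrow F k l → ∃ b α β, Good F θ c η τ δ k l b α β)
    {H : ℝ × ℝ → ℝ × ℝ} (cH : Continuous H)
    (hH : ∀ x, dist (H x) (F (psi θ c η τ hθ hc cθ cc x)) < δ) (n : ℕ) :
    ∀ (k : ℕ → ℤ × ℤ) (_ : ∀ i < n + 1, Arrow F (k i) (k (i + 1))) (b α β : ℝ)
      (_ : Good F θ c η τ δ (k 0) (k 1) b α β) (γ : ℝ → ℝ × ℝ) (_ : Continuous γ) (u v : ℝ)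
      (_ : Crossing c η τ (k 1) b γ u v),
      ∃ t ∈ uIcc u v, ∀ i ≤ n, H^[i] (γ t) ∈ cellC (k (i + 1)) := by
  have hη := (hθ 0).h1
  have base : ∀ (k l : ℤ × ℤ) (b α β : ℝ) (_ : Good F θ c η τ δ k l b α β) (γ : ℝ → ℝ × ℝ)
      (u v : ℝ) (_ : Crossing c η τ l b γ u v), ∀ t ∈ uIcc u v, γ t ∈ cellC l := by
    intro k l b α β G γ u v hcr t ht
    obtain ⟨h1, h2, h3⟩ := hcr.mem t ht
    obtain ⟨h4, h5, -⟩ := G.p2 _ h3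
    exact ⟨h1.le, h2.le, by linarith, by linarith⟩
  induction n with
  | zero =>
    intro k hk b α β G γ hγ u v hcr
    refine ⟨u, left_mem_uIcc, fun i hi => ?_⟩
    obtain rfl : i = 0 := by omega
    exact base _ _ _ _ _ G _ _ _ hcr _ left_mem_uIcc
  | succ n ih =>
    intro k hk b α β G γ hγ u v hcr
    obtain ⟨b', α', β', G'⟩ := hG _ _ (hk 1 (by omega))
    obtain ⟨u', v', hu', hv', hcr'⟩ := step hθ hc cθ cc G G' hH hγ hcr
    obtain ⟨t, ht, hti⟩ := ih (fun i => k (i + 1)) (fun i hi => hk (i + 1) (by omega))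
      b' α' β' G' (H ∘ γ) (cH.comp hγ) u' v' hcr'
    have ht' := uIcc_subset_uIcc hu' hv' ht
    refine ⟨t, ht', fun i hi => ?_⟩
    rcases i with _ | i
    · exact base _ _ _ _ _ G _ _ _ hcr _ ht'
    · exact hti i (by omega)

lemma realize {F : ℝ × ℝ → ℝ × ℝ} {θ c : ℝ → ℝ} {η τ δ : ℝ}
    (hθ : ∀ x, PlOk η (1 - η) (θ x - τ) (θ x + τ))
    (hc : ∀ x, PlOk η (1 - η) (c x - τ) (c x + τ)) (cθ : Continuous θ) (cc : Continuous c)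
    (hG : ∀ k l, Arrow F k l → ∃ b α β, Good F θ c η τ δ k l b α β)
    {H : ℝ × ℝ → ℝ × ℝ} (cH : Continuous H)
    (hH : ∀ x, dist (H x) (F (psi θ c η τ hθ hc cθ cc x)) < δ) (n : ℕ)
    (k : ℕ → ℤ × ℤ) (hk : ∀ i < n + 1, Arrow F (k i) (k (i + 1))) :
    ∃ z, ∀ i ≤ n, H^[i] z ∈ cellC (k (i + 1)) := by
  have hη := (hθ 0).h1
  obtain ⟨b, α, β, G⟩ := hG _ _ (hk 0 (by omega))
  obtain ⟨h1, h2, h3, h4, h5, h6⟩ := hc b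
  obtain ⟨t, -, ht⟩ := realize_aux hθ hc cθ cc hG cH hH n k hk b α β G (fun t => (t, b))
    (by fun_prop) ((k 1).1 + (c b - τ) / 2 * 1) ((k 1).1 + (c b + τ + 1) / 2) (by
      refine ⟨?_, ?_, ?_⟩
      · intro t ht
        rw [uIcc_of_le (by linarith)] at ht
        obtain ⟨h7, h8⟩ := ht
        refine ⟨?_, ?_, ?_⟩
        · dsimp only; linarith
        · dsimp only; linarith
        · simpa using hη
      · dsimp only; linarith
      · dsimp only; linarith)
  exact ⟨_, ht⟩

lemma cell_nhd1 (y : ℝ) : ∃ ε > 0, ∀ y', |y' - y| < ε → ∀ l : ℤ, (l : ℝ) ≤ y' → y' ≤ l + 1 →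
    (l : ℝ) ≤ y ∧ y ≤ l + 1 := by
  refine ⟨min (⌊y⌋ + 1 - y) (y - ⌈y⌉ + 1), lt_min ?_ ?_, ?_⟩
  · linarith [Int.lt_floor_add_one y]
  · linarith [Int.ceil_lt_add_one y]
  · intro y' hy' l h1 h2
    obtain ⟨h3, h4⟩ := lt_min_iff.1 hy'
    rw [abs_lt] at h3 h4
    constructor
    · by_contra! hlt
      have : ⌊y⌋ < l := Int.floor_lt.2 hlt
      have : (⌊y⌋ : ℝ) + 1 ≤ l := by exact_mod_cast this
      linarith
    · by_contra! hlt
      have : l + 1 < ⌈y⌉ := Int.lt_ceil.2 (by push_cast; exact hlt)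
      have : (l : ℝ) + 1 + 1 ≤ ⌈y⌉ := by exact_mod_cast this
      linarith

lemma cell_nhd (y : ℝ × ℝ) : ∃ ε > 0, ∀ y', dist y' y < ε → ∀ l, y' ∈ cellC l → y ∈ cellC l := by
  obtain ⟨e1, h1, H1⟩ := cell_nhd1 y.1
  obtain ⟨e2, h2, H2⟩ := cell_nhd1 y.2
  refine ⟨min e1 e2, lt_min h1 h2, fun y' hy' l hl => ?_⟩
  rw [Prod.dist_eq, max_lt_iff, Real.dist_eq, Real.dist_eq] at hy'
  have h3 := H1 y'.1 (hy'.1.trans_le (min_le_left _ _)) l.1 hl.1 hl.2.1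
  have h4 := H2 y'.2 (hy'.2.trans_le (min_le_right _ _)) l.2 hl.2.2.1 hl.2.2.2
  exact ⟨h3.1, h3.2, h4.1, h4.2⟩

lemma reduce {m : ℕ} (hm : 0 < m) (x : ℝ) : ∃ i : ℤ, x + m * i ∈ Icc (0 : ℝ) m := by
  have hm' : (0 : ℝ) < m := by exact_mod_cast hm
  refine ⟨-⌊x / m⌋, ?_, ?_⟩
  · have := Int.floor_le (x / m)
    rw [le_div_iff₀ hm'] at this
    push_cast; linarith
  · have := (Int.lt_floor_add_one (x / m)).le
    rw [div_le_iff₀ hm'] at this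
    push_cast; linarith

def bigBox (m : ℕ) : Set (ℝ × ℝ) := Icc (0 : ℝ) m ×ˢ Icc (0 : ℝ) m

lemma bigBox_compact (m : ℕ) : IsCompact (bigBox m) := isCompact_Icc.prod isCompact_Icc

lemma dist_shift (p q : ℝ × ℝ) (a b : ℝ) :
    dist (p.1 + a, p.2 + b) (q.1 + a, q.2 + b) = dist p q := by
  simp [Prod.dist_eq]

lemma cell_shift (m : ℕ) (i j : ℤ) (p : ℝ × ℝ) (k : ℤ × ℤ) (hp : p ∈ cellC k) :
    (p.1 + m * i, p.2 + m * j) ∈ cellC (k.1 + m * i, k.2 + m * j) := by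
  obtain ⟨h1, h2, h3, h4⟩ := hp
  refine ⟨?_, ?_, ?_, ?_⟩ <;> push_cast <;> linarith

lemma cellO_shift (m : ℕ) (i j : ℤ) (p : ℝ × ℝ) (k : ℤ × ℤ) (hp : p ∈ cellO k) :
    (p.1 + m * i, p.2 + m * j) ∈ cellO (k.1 + m * i, k.2 + m * j) := by
  obtain ⟨h1, h2, h3, h4⟩ := hp
  refine ⟨?_, ?_, ?_, ?_⟩ <;> push_cast <;> linarith

lemma Per.unif {m : ℕ} (hm : 0 < m) {F : ℝ × ℝ → ℝ × ℝ} (hF : Per m F) (cF : Continuous F)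
    {ε : ℝ} (hε : 0 < ε) : ∃ δ > 0, ∀ x x', dist x x' < δ → dist (F x) (F x') < ε := by
  have := (bigBox_compact m).uniformContinuousAt_of_continuousAt F
    (fun a _ => cF.continuousAt) (Metric.dist_mem_uniformity hε)
  obtain ⟨δ, hδ, h⟩ := Metric.mem_uniformity_dist.1 this
  refine ⟨δ, hδ, fun x x' hx => ?_⟩
  obtain ⟨i, hi⟩ := reduce hm x.1
  obtain ⟨j, hj⟩ := reduce hm x.2
  have h1 := h (a := (x.1 + m * i, x.2 + m * j)) (b := (x'.1 + m * i, x'.2 + m * j))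
    (by rwa [dist_shift]) ⟨hi, hj⟩
  simpa only [mem_ofPred_eq, hF _ _ _, dist_shift] using h1

lemma trans_local {m : ℕ} (hm : 0 < m) {G : ℝ × ℝ → ℝ × ℝ} (hG : Per m G) (cG : Continuous G) :
    ∃ δ > 0, ∀ x y, dist y (G x) < δ → ∀ k l, x ∈ cellC k → y ∈ cellC l →
      ∃ x0 ∈ cellC k, G x0 ∈ cellC l := by
  have : ∃ δ > 0, ∀ x ∈ bigBox m, ∀ y, dist y (G x) < δ → ∀ k l, x ∈ cellC k → y ∈ cellC l →
      ∃ x0 ∈ cellC k, G x0 ∈ cellC l := by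
    refine (bigBox_compact m).induction_on (p := fun s => ∃ δ > 0, ∀ x ∈ s, ∀ y, dist y (G x) < δ →
      ∀ k l, x ∈ cellC k → y ∈ cellC l → ∃ x0 ∈ cellC k, G x0 ∈ cellC l) ?_ ?_ ?_ ?_
    · exact ⟨1, one_pos, by simp⟩
    · rintro s t hst ⟨δ, hδ, h⟩
      exact ⟨δ, hδ, fun x hx => h x (hst hx)⟩
    · rintro s t ⟨δ, hδ, h⟩ ⟨δ', hδ', h'⟩
      refine ⟨min δ δ', lt_min hδ hδ', fun x hx y hy => ?_⟩
      rcases hx with hx | hx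
      · exact h x hx y (hy.trans_le (min_le_left _ _))
      · exact h' x hx y (hy.trans_le (min_le_right _ _))
    · intro x _
      obtain ⟨e1, he1, H1⟩ := cell_nhd x
      obtain ⟨e2, he2, H2⟩ := cell_nhd (G x)
      obtain ⟨e3, he3, H3⟩ := Metric.continuous_iff.1 cG x (e2 / 2) (by positivity)
      refine ⟨ball x (min e1 e3), mem_nhdsWithin_of_mem_nhds
        (ball_mem_nhds _ (lt_min he1 he3)), e2 / 2, by positivity, ?_⟩
      intro x' hx' y hy k l hk hl
      obtain ⟨h1, h2⟩ := lt_min_iff.1 (mem_ball.1 hx')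
      refine ⟨x, H1 x' h1 k hk, H2 y ?_ l hl⟩
      calc dist y (G x) ≤ dist y (G x') + dist (G x') (G x) := dist_triangle _ _ _
        _ < e2 / 2 + e2 / 2 := add_lt_add hy (H3 x' h2)
        _ = e2 := by ring
  obtain ⟨δ, hδ, h⟩ := this
  refine ⟨δ, hδ, fun x y hxy k l hk hl => ?_⟩
  obtain ⟨i, hi⟩ := reduce hm x.1
  obtain ⟨j, hj⟩ := reduce hm x.2
  obtain ⟨x0, h1, h2⟩ := h (x.1 + m * i, x.2 + m * j) ⟨hi, hj⟩ (y.1 + m * i, y.2 + m * j)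
    (by rwa [hG, dist_shift]) _ _ (cell_shift m i j x k hk) (cell_shift m i j y l hl)
  refine ⟨(x0.1 + m * (-i : ℤ), x0.2 + m * (-j : ℤ)), ?_, ?_⟩
  · have := cell_shift m (-i) (-j) x0 _ h1
    simpa using this
  · rw [hG]
    have := cell_shift m (-i) (-j) _ _ h2
    simpa using this

lemma avoid {f g : ℝ × ℝ → ℝ} (cf : Continuous f) (cg : Continuous g) (of : IsOpenMap f)
    (og : IsOpenMap g) {A B : Set ℝ} (hA : A.Countable) (hB : B.Countable) {U : Set (ℝ × ℝ)}
    (hU : IsOpen U) (hne : U.Nonempty) : ∃ x ∈ U, f x ∉ A ∧ g x ∉ B := by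
  have h1 : Dense (f ⁻¹' Aᶜ) := (hA.dense_compl ℝ).preimage of
  have h2 : Dense (g ⁻¹' Bᶜ) := (hB.dense_compl ℝ).preimage og
  have h3 : IsGδ (f ⁻¹' Aᶜ) := hA.isGδ_compl.preimage cf
  have h4 : IsGδ (g ⁻¹' Bᶜ) := hB.isGδ_compl.preimage cg
  obtain ⟨x, hx, hx'⟩ := (h1.inter_of_Gδ h3 h4 h2).inter_open_nonempty U hU hne
  exact ⟨x, hx, hx'.1, hx'.2⟩

lemma countable_fiber (m : ℝ) (c : AddCircle m) : {x : ℝ | (x : AddCircle m) = c}.Countable := by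
  obtain ⟨y, rfl⟩ := QuotientAddGroup.mk_surjective c
  refine (countable_range (fun n : ℤ => y + n • m)).mono ?_
  intro x hx
  have := (QuotientAddGroup.eq (s := AddSubgroup.zmultiples m)).1 (Eq.symm hx)
  obtain ⟨n, hn⟩ := AddSubgroup.mem_zmultiples_iff.1 this
  exact ⟨n, by simp only [hn]; ring⟩

lemma select {m : ℝ} (F : ℝ × ℝ ≃ₜ ℝ × ℝ) {ι : Type*} [Finite ι] (U : ι → Set (ℝ × ℝ))
    (hU : ∀ i, IsOpen (U i)) (hne : ∀ i, (U i).Nonempty) :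
    ∃ z : ι → ℝ × ℝ, (∀ i, z i ∈ U i) ∧ ∀ i j, i ≠ j →
      ((z i).1 : AddCircle m) ≠ ((z j).1 : AddCircle m) ∧
      ((F (z i)).2 : AddCircle m) ≠ ((F (z j)).2 : AddCircle m) := by
  classical
  cases nonempty_fintype ι
  suffices h : ∀ s : Finset ι, ∃ z : ι → ℝ × ℝ, (∀ i ∈ s, z i ∈ U i) ∧
      ∀ i ∈ s, ∀ j ∈ s, i ≠ j → ((z i).1 : AddCircle m) ≠ ((z j).1 : AddCircle m) ∧
      ((F (z i)).2 : AddCircle m) ≠ ((F (z j)).2 : AddCircle m) by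
    obtain ⟨z, h1, h2⟩ := h Finset.univ
    exact ⟨z, fun i => h1 i (Finset.mem_univ _),
      fun i j => h2 i (Finset.mem_univ _) j (Finset.mem_univ _)⟩
  intro s
  induction s using Finset.induction_on with
  | empty => exact ⟨fun _ => 0, by simp, by simp⟩
  | insert a s ha ih =>
    obtain ⟨z, h1, h2⟩ := ih
    obtain ⟨x, hx, hx1, hx2⟩ := avoid (f := Prod.fst) (g := fun p => (F p).2) continuous_fst
      (continuous_snd.comp F.continuous) isOpenMap_fst (isOpenMap_snd.comp F.isOpenMap)
      (A := ⋃ i ∈ s, {x : ℝ | (x : AddCircle m) = ((z i).1 : AddCircle m)})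
      (B := ⋃ i ∈ s, {x : ℝ | (x : AddCircle m) = ((F (z i)).2 : AddCircle m)})
      (s.countable_toSet.biUnion fun i _ => countable_fiber _ _)
      (s.countable_toSet.biUnion fun i _ => countable_fiber _ _) (hU a) (hne a)
    simp only [mem_iUnion, mem_ofPred_eq, not_exists] at hx1 hx2
    have hne' : ∀ i ∈ s, i ≠ a := fun i hi e => ha (e ▸ hi)
    refine ⟨Function.update z a x, ?_, ?_⟩
    · intro i hi
      rcases Finset.mem_insert.1 hi with rfl | hi
      · simpa using hx
      · simpa [Function.update_of_ne (hne' i hi)] using h1 i hi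
    · intro i hi j hj hij
      rcases Finset.mem_insert.1 hi with e | hi' <;> rcases Finset.mem_insert.1 hj with e' | hj'
      · exact absurd (e.trans e'.symm) hij
      · subst e
        rw [Function.update_self, Function.update_of_ne (hne' j hj')]
        exact ⟨hx1 j hj', hx2 j hj'⟩
      · subst e'
        rw [Function.update_self, Function.update_of_ne (hne' i hi')]
        exact ⟨fun h => hx1 i hi' h.symm, fun h => hx2 i hi' h.symm⟩
      · rw [Function.update_of_ne (hne' i hi'), Function.update_of_ne (hne' j hj')]
        exact h2 i hi' j hj' hij

lemma interp {X ι : Type*} [PseudoMetricSpace X] (s : Finset ι) (a : ι → X) {η : ℝ} (hη : 0 < η)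
    (sep : ∀ i j, i ≠ j → 4 * η ≤ dist (a i) (a j)) (v : ι → X → ℝ) (cv : ∀ i, Continuous (v i))
    {lo hi : ℝ} (hlo : lo ≤ hi) (hv : ∀ i x, lo ≤ v i x ∧ v i x ≤ hi) :
    ∃ θ : X → ℝ, Continuous θ ∧ (∀ x, lo ≤ θ x ∧ θ x ≤ hi) ∧
      ∀ i ∈ s, ∀ x, dist x (a i) ≤ η → θ x = v i x := by
  classical
  induction s using Finset.induction_on with
  | empty => exact ⟨fun _ => lo, continuous_const, fun _ => ⟨le_refl _, hlo⟩, by simp⟩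
  | insert j s hj ih =>
    obtain ⟨θ, cθ, bθ, eθ⟩ := ih
    set B : X → ℝ := fun x => max 0 (min 1 (2 - dist x (a j) / η)) with hB
    have B0 : ∀ x, 0 ≤ B x := fun x => le_max_left _ _
    have B1 : ∀ x, B x ≤ 1 := fun x => max_le zero_le_one (min_le_left _ _)
    refine ⟨fun x => (1 - B x) * θ x + B x * v j x, ?_, ?_, ?_⟩
    · have := cv j
      have : Continuous B := by fun_prop
      fun_prop
    · intro x
      obtain ⟨h1, h2⟩ := bθ x
      obtain ⟨h3, h4⟩ := hv j x
      have := B0 x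
      have := B1 x
      constructor <;> nlinarith
    · intro i hi x hx
      rcases Finset.mem_insert.1 hi with e | hi
      · subst e
        have : B x = 1 := by
          have : dist x (a i) / η ≤ 1 := by rwa [div_le_one hη]
          rw [hB]
          dsimp only
          rw [min_eq_left (by linarith), max_eq_right zero_le_one]
        simp [this]
      · have hne : i ≠ j := fun e => hj (e ▸ hi)
        have : B x = 0 := by
          have h1 := sep i j hne
          have h2 := dist_triangle_left (a i) (a j) x
          have : 2 ≤ dist x (a j) / η := by rw [le_div_iff₀ hη]; linarith
          rw [hB]
          dsimp only
          rw [max_eq_left]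
          exact (min_le_right _ _).trans (by linarith)
        simp [this, eθ i hi x hx]

lemma Good.translate {m : ℕ} {F : ℝ × ℝ → ℝ × ℝ} (hF : Per m F) {θ c : ℝ → ℝ}
    (pθ : ∀ (x : ℝ) (i : ℤ), θ (x + m * i) = θ x)
    (pc : ∀ (x : ℝ) (i : ℤ), c (x + m * i) = c x) {η τ δ : ℝ} {k l : ℤ × ℤ} {b α β : ℝ}
    (G : Good F θ c η τ δ k l b α β) (i j : ℤ) :
    Good F θ c η τ δ (k.1 + m * i, k.2 + m * j) (l.1 + m * i, l.2 + m * j) (b + m * j)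
      (α + m * i) (β + m * i) := by
  obtain ⟨p1, p1', p1b, p1b', p2, p3, p4, p5⟩ := G
  have key : ∀ (x y : ℝ) (q : ℝ × ℝ), dist q (F (x, y)) < δ →
      dist (q.1 - m * i, q.2 - m * j) (F (x - m * i, y - m * j)) < δ := by
    intro x y q h
    have h1 := hF (x - m * i, y - m * j) i j
    simp only [sub_add_cancel] at h1
    rw [h1] at h
    rw [← dist_shift _ _ (m * i) (m * j)]
    simpa using h
  have pθ' : ∀ (x : ℝ) (i : ℤ), θ (x - m * i) = θ x := fun x i => by
    have := pθ (x - m * i) i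
    rwa [sub_add_cancel, eq_comm] at this
  refine ⟨?_, ?_, ?_, ?_, ?_, ?_, ?_, ?_⟩
  · push_cast; linarith
  · push_cast; linarith
  · push_cast; linarith
  · push_cast; linarith
  · intro y hy
    obtain ⟨h1, h2, h3⟩ := p2 (y - m * j) (by rwa [sub_sub, add_comm])
    have h4 := pc (y - m * j) j
    rw [sub_add_cancel] at h4
    push_cast
    rw [pc, h4]
    refine ⟨by linarith, by linarith, h3⟩
  · intro x hx y hy q hq
    have hx' : x - m * i ∈ uIcc α β := by
      rw [mem_uIcc] at hx ⊢
      rcases hx with hx | hx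
      · left; constructor <;> linarith [hx.1, hx.2]
      · right; constructor <;> linarith [hx.1, hx.2]
    obtain ⟨h1, h2, h3⟩ := p3 _ hx' (y - m * j) (by
      rw [pθ']; push_cast at hy; convert hy using 2; ring) _ (key _ _ _ hq)
    dsimp only at h1 h2 h3
    push_cast
    refine ⟨by linarith, by linarith, ?_⟩
    convert h3 using 2; ring
  · intro y hy q hq
    have h1 := key _ _ _ hq
    rw [add_sub_cancel_right] at h1
    have := p4 (y - m * j) (by
      rw [pθ] at hy; push_cast at hy; convert hy using 2; ring) _ h1
    dsimp only at this
    push_cast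
    rw [pc]
    linarith
  · intro y hy q hq
    have h1 := key _ _ _ hq
    rw [add_sub_cancel_right] at h1
    have := p5 (y - m * j) (by
      rw [pθ] at hy; push_cast at hy; convert hy using 2; ring) _ h1
    dsimp only at this
    push_cast
    rw [pc]
    linarith

lemma fin_min {ι : Type*} [Finite ι] (f : ι → ℝ) (hf : ∀ i, 0 < f i) : ∃ η > 0, ∀ i, η ≤ f i := by
  have h : ∀ᶠ η in 𝓝[>] (0 : ℝ), ∀ i, η ≤ f i := by
    rw [Filter.eventually_all]
    intro i
    filter_upwards [Ioo_mem_nhdsGT (hf i)] with x hx using hx.2.le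
  obtain ⟨η, h1, h2⟩ := (h.and self_mem_nhdsWithin).exists
  exact ⟨η, h2, h1⟩

lemma pick (F : ℝ × ℝ ≃ₜ ℝ × ℝ) (z : ℝ × ℝ) {r : ℝ} (hr : 0 < r) :
    ∃ A B : ℝ × ℝ, dist A z ≤ r ∧ dist B z ≤ r ∧ A.1 ≠ B.1 ∧ (F A).1 < (F B).1 := by
  obtain ⟨x, hx, h1, h2⟩ := avoid (f := Prod.fst) (g := fun p => (F p).1) continuous_fst
      (continuous_fst.comp F.continuous) isOpenMap_fst (isOpenMap_fst.comp F.isOpenMap)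
      (countable_singleton z.1) (countable_singleton (F z).1) (isOpen_ball (x := z) (ε := r))
      ⟨z, mem_ball_self hr⟩
  rw [mem_singleton_iff] at h1 h2
  rcases lt_or_gt_of_ne h2 with h | h
  · exact ⟨x, z, (mem_ball.1 hx).le, by simpa using hr.le, h1, h⟩
  · exact ⟨z, x, by simpa using hr.le, (mem_ball.1 hx).le, Ne.symm h1, h⟩

lemma ramp {m a b : ℝ} (hne : (a : AddCircle m) ≠ (b : AddCircle m)) (y y' : ℝ) :
    ∃ v : AddCircle m → ℝ, Continuous v ∧ v a = y ∧ v b = y' ∧ ∀ x, v x ∈ uIcc y y' := by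
  have hd : 0 < dist (b : AddCircle m) (a : AddCircle m) := dist_pos.2 (Ne.symm hne)
  refine ⟨fun x => y + (y' - y) * min 1 (dist x (a : AddCircle m) / dist (b : AddCircle m) a),
    by fun_prop, by simp, ?_, ?_⟩
  · dsimp only; rw [div_self hd.ne']; simp
  · intro x
    have h0 : 0 ≤ min 1 (dist x (a : AddCircle m) / dist (b : AddCircle m) a) := by positivity
    have h1 : min 1 (dist x (a : AddCircle m) / dist (b : AddCircle m) a) ≤ 1 := min_le_left _ _
    rw [mem_uIcc]
    rcases le_total y y' with h | h
    · left; constructor <;> nlinarith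
    · right; constructor <;> nlinarith

lemma dist_lt_iff' {p q : ℝ × ℝ} {r : ℝ} (h : dist p q < r) :
    |p.1 - q.1| < r ∧ |p.2 - q.2| < r := by
  rwa [Prod.dist_eq, max_lt_iff, Real.dist_eq, Real.dist_eq] at h

lemma dist_le_iff' {p q : ℝ × ℝ} {r : ℝ} (h : dist p q ≤ r) :
    |p.1 - q.1| ≤ r ∧ |p.2 - q.2| ≤ r := by
  rwa [Prod.dist_eq, max_le_iff, Real.dist_eq, Real.dist_eq] at h

lemma uIcc_close {a b x z r : ℝ} (hx : x ∈ uIcc a b) (ha : |a - z| ≤ r) (hb : |b - z| ≤ r) :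
    |x - z| ≤ r := by
  rw [abs_le] at *
  rcases mem_uIcc.1 hx with h | h <;> constructor <;> linarith [h.1, h.2]

lemma goodOf {F : ℝ × ℝ → ℝ × ℝ} {θ c : ℝ → ℝ} {η τ δ ζ r : ℝ} {k l : ℤ × ℤ} {z A B : ℝ × ℝ}
    (hη : 0 < η) (k1 : k.1 + 2 * η ≤ z.1) (k1' : z.1 ≤ k.1 + (1 - 2 * η))
    (l1 : l.1 + 2 * η ≤ (F z).1) (l1' : (F z).1 ≤ l.1 + (1 - 2 * η))
    (l2 : l.2 + 2 * η ≤ (F z).2) (l2' : (F z).2 ≤ l.2 + (1 - 2 * η))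
    (hrη : r ≤ η) (hA : dist A z ≤ r) (hB : dist B z ≤ r)
    (hr : ∀ x, dist x z ≤ r → dist (F x) (F z) < η / 2)
    (hθ : ∀ x ∈ uIcc A.1 B.1, k.2 + θ x ∈ uIcc A.2 B.2) (hθA : k.2 + θ A.1 = A.2)
    (hθB : k.2 + θ B.1 = B.2)
    (hc : ∀ y, |y - (F z).2| ≤ η → l.1 + c y = ((F A).1 + (F B).1) / 2)
    (hζ : 8 * ζ ≤ η) (hζ' : 8 * ζ ≤ (F B).1 - (F A).1)
    (hτ : ∀ x y y', |y - y'| ≤ τ → dist (F (x, y)) (F (x, y')) < ζ) (hτζ : τ ≤ ζ) (hδ : δ ≤ ζ) :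
    Good F θ c η τ δ k l (F z).2 A.1 B.1 := by
  have a := dist_le_iff' hA
  have b := dist_le_iff' hB
  have cb := hc (F z).2 (by simpa using hη.le)
  have a1 := abs_le.1 a.1
  have b1 := abs_le.1 b.1
  refine ⟨by linarith, by linarith, by linarith, by linarith, ?_, ?_, ?_, ?_⟩
  · intro y hy
    have := hc y hy.le
    rw [abs_lt] at hy
    exact ⟨by linarith, by linarith, by linarith⟩
  · intro x hx y hy q hq
    have h1 : dist (x, k.2 + θ x) z ≤ r := by
      rw [Prod.dist_eq]
      exact max_le (uIcc_close hx a.1 b.1) (uIcc_close (hθ x hx) a.2 b.2)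
    have h2 := hr _ h1
    have h3 := hτ x _ _ hy
    have h4 : dist q (F z) < η := by
      have := dist_triangle4 q (F (x, y)) (F (x, k.2 + θ x)) (F z)
      linarith
    obtain ⟨h5, h6⟩ := dist_lt_iff' h4
    rw [abs_lt] at h5
    exact ⟨by linarith, by linarith, h6⟩
  · intro y hy q hq
    have h3 := hτ A.1 _ _ hy
    rw [hθA] at h3
    have h4 : dist q (F A) < 2 * ζ := by
      have := dist_triangle q (F (A.1, y)) (F A)
      linarith
    have h5 := abs_lt.1 (dist_lt_iff' h4).1
    linarith
  · intro y hy q hq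
    have h3 := hτ B.1 _ _ hy
    rw [hθB] at h3
    have h4 : dist q (F B) < 2 * ζ := by
      have := dist_triangle q (F (B.1, y)) (F B)
      linarith
    have h5 := abs_lt.1 (dist_lt_iff' h4).1
    linarith

lemma cellO_open (k : ℤ × ℤ) : IsOpen (cellO k) := by
  have : cellO k = Ioo (k.1 : ℝ) (k.1 + 1) ×ˢ Ioo (k.2 : ℝ) (k.2 + 1) := by
    ext p; simp [cellO, and_assoc]
  rw [this]; exact isOpen_Ioo.prod isOpen_Ioo

lemma cellO_margin {k : ℤ × ℤ} {p : ℝ × ℝ} (hp : p ∈ cellO k) : ∃ μ > 0, k.1 + μ ≤ p.1 ∧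
    p.1 ≤ k.1 + (1 - μ) ∧ k.2 + μ ≤ p.2 ∧ p.2 ≤ k.2 + (1 - μ) := by
  obtain ⟨h1, h2, h3, h4⟩ := hp
  refine ⟨min (min (p.1 - k.1) (k.1 + 1 - p.1)) (min (p.2 - k.2) (k.2 + 1 - p.2)), ?_, ?_⟩
  · refine lt_min (lt_min ?_ ?_) (lt_min ?_ ?_) <;> linarith
  · set M := min (min (p.1 - k.1) (k.1 + 1 - p.1)) (min (p.2 - k.2) (k.2 + 1 - p.2)) with hM
    have a1 : M ≤ p.1 - k.1 := (min_le_left _ _).trans (min_le_left _ _)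
    have a2 : M ≤ k.1 + 1 - p.1 := (min_le_left _ _).trans (min_le_right _ _)
    have a3 : M ≤ p.2 - k.2 := (min_le_right _ _).trans (min_le_left _ _)
    have a4 : M ≤ k.2 + 1 - p.2 := (min_le_right _ _).trans (min_le_right _ _)
    refine ⟨?_, ?_, ?_, ?_⟩ <;> linarith

def BaseArr (m : ℕ) (F : ℝ × ℝ → ℝ × ℝ) : Set ((ℤ × ℤ) × (ℤ × ℤ)) :=
  {e | 0 ≤ e.1.1 ∧ e.1.1 < m ∧ 0 ≤ e.1.2 ∧ e.1.2 < m ∧ Arrow F e.1 e.2}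

lemma BaseArr_finite (m : ℕ) {F : ℝ × ℝ → ℝ × ℝ} (cF : Continuous F) : (BaseArr m F).Finite := by
  have h := ((bigBox_compact m).image cF).isBounded
  obtain ⟨R, hR⟩ := h.subset_closedBall 0
  refine (Set.finite_Icc (((0 : ℤ), (0 : ℤ)), (-⌈R⌉ - 1, -⌈R⌉ - 1))
    (((m : ℤ), (m : ℤ)), (⌈R⌉, ⌈R⌉))).subset ?_
  rintro ⟨⟨k1, k2⟩, ⟨l1, l2⟩⟩ ⟨h1, h2, h3, h4, x, ⟨x1, x2, x3, x4⟩, ⟨y1, y2, y3, y4⟩⟩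
  dsimp only at *
  have hx : x ∈ bigBox m := by
    have e1 : (0 : ℝ) ≤ k1 := by exact_mod_cast h1
    have e2 : (k1 : ℝ) + 1 ≤ m := by exact_mod_cast h2
    have e3 : (0 : ℝ) ≤ k2 := by exact_mod_cast h3
    have e4 : (k2 : ℝ) + 1 ≤ m := by exact_mod_cast h4
    refine ⟨⟨?_, ?_⟩, ?_, ?_⟩ <;> linarith
  have hb := dist_le_iff' (mem_closedBall.1 (hR ⟨x, hx, rfl⟩))
  have hc := Int.le_ceil R
  simp only [Prod.fst_zero, Prod.snd_zero, sub_zero, abs_le] at hb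
  have b1 : -⌈R⌉ - 1 ≤ l1 := by
    have : (-⌈R⌉ - 1 : ℝ) ≤ l1 := by linarith [hb.1.1]
    exact_mod_cast this
  have b2 : -⌈R⌉ - 1 ≤ l2 := by
    have : (-⌈R⌉ - 1 : ℝ) ≤ l2 := by linarith [hb.2.1]
    exact_mod_cast this
  have b3 : l1 ≤ ⌈R⌉ := by
    have : (l1 : ℝ) ≤ ⌈R⌉ := by linarith [hb.1.2]
    exact_mod_cast this
  have b4 : l2 ≤ ⌈R⌉ := by
    have : (l2 : ℝ) ≤ ⌈R⌉ := by linarith [hb.2.2]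
    exact_mod_cast this
  exact ⟨⟨⟨h1, h3⟩, ⟨b1, b2⟩⟩, ⟨⟨h2.le, h4.le⟩, ⟨b3, b4⟩⟩⟩

lemma coe_dist_le (m : ℝ) (x y : ℝ) : dist (x : AddCircle m) (y : AddCircle m) ≤ |x - y| := by
  rw [dist_eq_norm, ← AddCircle.coe_sub]
  exact (QuotientAddGroup.norm_mk_le_norm).trans_eq (Real.norm_eq_abs _)

lemma coe_ne {m : ℝ} (hm : 1 ≤ m) {x y : ℝ} (hne : x ≠ y) (h : |x - y| < 1) :
    (x : AddCircle m) ≠ (y : AddCircle m) := by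
  intro e
  have := (QuotientAddGroup.eq (s := AddSubgroup.zmultiples m)).1 e.symm
  obtain ⟨n, hn⟩ := AddSubgroup.mem_zmultiples_iff.1 this
  have hn' : (n : ℝ) * m = x - y := by rw [zsmul_eq_mul] at hn; linarith
  have hn0 : n ≠ 0 := by
    rintro rfl
    apply hne
    simp only [Int.cast_zero, zero_mul] at hn'
    linarith
  have h1 : (1 : ℝ) ≤ |(n : ℝ)| := by exact_mod_cast Int.one_le_abs hn0
  rw [← hn', abs_mul, abs_of_nonneg (by linarith : (0:ℝ) ≤ m)] at h
  nlinarith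

lemma coe_per (m : ℕ) (x : ℝ) (i : ℤ) :
    ((x + m * i : ℝ) : AddCircle (m : ℝ)) = (x : AddCircle (m : ℝ)) := by
  rw [AddCircle.coe_add, mul_comm, ← zsmul_eq_mul, AddCircle.coe_zsmul, AddCircle.coe_period]
  simp

lemma data {m : ℕ} (hm : 0 < m) (F : ℝ × ℝ ≃ₜ ℝ × ℝ) (hF : Per m F) :
    ∃ (θ c : ℝ → ℝ) (η τ δ : ℝ), (∀ x, PlOk η (1 - η) (θ x - τ) (θ x + τ)) ∧
      (∀ x, PlOk η (1 - η) (c x - τ) (c x + τ)) ∧ Continuous θ ∧ Continuous c ∧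
      (∀ (x : ℝ) (i : ℤ), θ (x + m * i) = θ x) ∧ (∀ (x : ℝ) (i : ℤ), c (x + m * i) = c x) ∧
      0 < δ ∧ ∀ k l, Arrow F k l → ∃ b α β, Good F θ c η τ δ k l b α β := by
  classical
  have hm1 : (1 : ℝ) ≤ m := by exact_mod_cast hm
  have fin := BaseArr_finite m F.continuous
  have : Finite (BaseArr m F) := fin
  cases nonempty_fintype (BaseArr m F)
  obtain ⟨z, hz, hsep⟩ := select (m := (m : ℝ)) F
    (fun e : BaseArr m F => cellO e.1.1 ∩ F ⁻¹' (cellO e.1.2))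
    (fun e => (cellO_open _).inter ((cellO_open _).preimage F.continuous))
    (fun e => e.2.2.2.2.2)
  choose μ hμ0 hμ using fun e => cellO_margin (hz e).1
  choose ν hν0 hν using fun e => cellO_margin (hz e).2
  obtain ⟨η1, hη1, h1⟩ := fin_min μ hμ0
  obtain ⟨η2, hη2, h2⟩ := fin_min ν hν0
  obtain ⟨η3, hη3, h3⟩ := fin_min (fun p : BaseArr m F × BaseArr m F => if p.1 = p.2 then 1 else
    dist ((z p.1).1 : AddCircle (m : ℝ)) (z p.2).1) (by
      intro p
      split_ifs with h
      · exact one_pos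
      · exact dist_pos.2 (hsep _ _ h).1)
  obtain ⟨η4, hη4, h4⟩ := fin_min (fun p : BaseArr m F × BaseArr m F => if p.1 = p.2 then 1 else
    dist ((F (z p.1)).2 : AddCircle (m : ℝ)) (F (z p.2)).2) (by
      intro p
      split_ifs with h
      · exact one_pos
      · exact dist_pos.2 (hsep _ _ h).2)
  obtain ⟨η, hη, η1', η2', η3', η4', η5'⟩ : ∃ η > 0, 2 * η ≤ η1 ∧ 2 * η ≤ η2 ∧ 4 * η ≤ η3 ∧
      4 * η ≤ η4 ∧ 8 * η ≤ 1 := by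
    refine ⟨min (min η1 η2) (min (min η3 η4) 1) / 8, by positivity, ?_⟩
    set M := min (min η1 η2) (min (min η3 η4) 1) with hM
    have m1 : M ≤ η1 := (min_le_left _ _).trans (min_le_left _ _)
    have m2 : M ≤ η2 := (min_le_left _ _).trans (min_le_right _ _)
    have m3 : M ≤ η3 := (min_le_right _ _).trans ((min_le_left _ _).trans (min_le_left _ _))
    have m4 : M ≤ η4 := (min_le_right _ _).trans ((min_le_left _ _).trans (min_le_right _ _))
    have m5 : M ≤ 1 := (min_le_right _ _).trans (min_le_right _ _)
    have m0 : 0 < M := by positivity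
    refine ⟨?_, ?_, ?_, ?_, ?_⟩ <;> linarith
  have hzk : ∀ e, e.1.1.1 + 2 * η ≤ (z e).1 ∧ (z e).1 ≤ e.1.1.1 + (1 - 2 * η) ∧
      e.1.1.2 + 2 * η ≤ (z e).2 ∧ (z e).2 ≤ e.1.1.2 + (1 - 2 * η) := by
    intro e
    obtain ⟨a1, a2, a3, a4⟩ := hμ e
    have := h1 e
    refine ⟨?_, ?_, ?_, ?_⟩ <;> linarith
  have hzl : ∀ e, e.1.2.1 + 2 * η ≤ (F (z e)).1 ∧ (F (z e)).1 ≤ e.1.2.1 + (1 - 2 * η) ∧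
      e.1.2.2 + 2 * η ≤ (F (z e)).2 ∧ (F (z e)).2 ≤ e.1.2.2 + (1 - 2 * η) := by
    intro e
    obtain ⟨a1, a2, a3, a4⟩ := hν e
    have := h2 e
    refine ⟨?_, ?_, ?_, ?_⟩ <;> linarith
  clear h1 h2 hμ hν
  have sep1 : ∀ i j, i ≠ j → 4 * η ≤ dist ((z i).1 : AddCircle (m : ℝ)) (z j).1 := by
    intro i j hij
    have := h3 (i, j)
    simp only [if_neg hij] at this
    linarith
  have sep2 : ∀ i j, i ≠ j → 4 * η ≤ dist ((F (z i)).2 : AddCircle (m : ℝ)) (F (z j)).2 := by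
    intro i j hij
    have := h4 (i, j)
    simp only [if_neg hij] at this
    linarith
  obtain ⟨r0, hr0, Hr0⟩ := hF.unif hm F.continuous (ε := η / 2) (by linarith)
  obtain ⟨r, hr, hrη, hrr⟩ : ∃ r > 0, r ≤ η ∧ r < r0 :=
    ⟨min η (r0 / 2), by positivity, min_le_left _ _, (min_le_right _ _).trans_lt (by linarith)⟩
  choose A B hA hB hAB hFAB using fun e => pick F (z e) hr
  have A' := fun e => dist_le_iff' (hA e)
  have B' := fun e => dist_le_iff' (hB e)
  have FA := fun e => dist_lt_iff' (Hr0 _ _ ((hA e).trans_lt hrr))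
  have FB := fun e => dist_lt_iff' (Hr0 _ _ ((hB e).trans_lt hrr))
  have hne : ∀ e, ((A e).1 : AddCircle (m : ℝ)) ≠ (B e).1 := by
    intro e
    refine coe_ne hm1 (hAB e) ?_
    have h1 := abs_le.1 (A' e).1
    have h2 := abs_le.1 (B' e).1
    rw [abs_lt]; constructor <;> linarith
  choose v cv vA vB hv using fun e => ramp (hne e) ((A e).2 - e.1.1.2) ((B e).2 - e.1.1.2)
  obtain ⟨θ, cθ, bθ, eθ⟩ := interp Finset.univ (fun e => ((z e).1 : AddCircle (m : ℝ))) hη sep1 v cv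
    (lo := η) (hi := 1 - η) (by linarith) (by
      intro e x
      have h1 := abs_le.1 (A' e).2
      have h2 := abs_le.1 (B' e).2
      obtain ⟨-, -, h3, h4⟩ := hzk e
      rcases mem_uIcc.1 (hv e x) with h | h <;> constructor <;> linarith [h.1, h.2])
  obtain ⟨c, cc, bc, ec⟩ := interp Finset.univ (fun e => ((F (z e)).2 : AddCircle (m : ℝ))) hη sep2
    (fun e _ => ((F (A e)).1 + (F (B e)).1) / 2 - e.1.2.1) (fun e => continuous_const)
    (lo := η) (hi := 1 - η) (by linarith) (by
      intro e x
      have h1 := abs_lt.1 (FA e).1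
      have h2 := abs_lt.1 (FB e).1
      obtain ⟨h3, h4, -⟩ := hzl e
      constructor <;> linarith)
  obtain ⟨ζ1, hζ1, h5⟩ := fin_min (fun e => (F (B e)).1 - (F (A e)).1)
    (fun e => by linarith [hFAB e])
  obtain ⟨ζ, hζ, hζη, hζF⟩ : ∃ ζ > 0, 8 * ζ ≤ η ∧ 8 * ζ ≤ ζ1 :=
    ⟨min η ζ1 / 8, by positivity, by linarith [min_le_left η ζ1], by linarith [min_le_right η ζ1]⟩
  obtain ⟨ω, hω, Hω⟩ := hF.unif hm F.continuous hζ
  obtain ⟨τ, hτ, hτω, hτζ⟩ : ∃ τ > 0, τ < ω ∧ τ ≤ ζ :=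
    ⟨min (ω / 2) ζ, by positivity, (min_le_left _ _).trans_lt (by linarith), min_le_right _ _⟩
  have pθ : ∀ (x : ℝ) (i : ℤ), θ ((x + m * i : ℝ) : AddCircle (m : ℝ)) = θ x := by
    intro x i; rw [coe_per]
  have pc : ∀ (x : ℝ) (i : ℤ), c ((x + m * i : ℝ) : AddCircle (m : ℝ)) = c x := by
    intro x i; rw [coe_per]
  refine ⟨fun x => θ (x : AddCircle (m : ℝ)), fun x => c (x : AddCircle (m : ℝ)), η, τ, ζ, ?_, ?_,
    cθ.comp (AddCircle.continuous_mk' _), cc.comp (AddCircle.continuous_mk' _), pθ, pc, hζ, ?_⟩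
  · intro x
    obtain ⟨h6, h7⟩ := bθ x
    constructor <;> linarith
  · intro x
    obtain ⟨h6, h7⟩ := bc x
    constructor <;> linarith
  have main : ∀ e : BaseArr m F, Good F (fun x => θ (x : AddCircle (m : ℝ)))
      (fun x => c (x : AddCircle (m : ℝ))) η τ ζ e.1.1 e.1.2 (F (z e)).2 (A e).1 (B e).1 := by
    intro e
    have θv : ∀ x : ℝ, x ∈ uIcc (A e).1 (B e).1 → θ (x : AddCircle (m : ℝ)) = v e x := by
      intro x hx
      refine eθ e (Finset.mem_univ _) _ ((coe_dist_le _ _ _).trans ?_)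
      exact (uIcc_close hx (A' e).1 (B' e).1).trans hrη
    obtain ⟨k1, k2, k3, k4⟩ := hzk e
    obtain ⟨l1, l2, l3, l4⟩ := hzl e
    refine goodOf (ζ := ζ) (r := r) hη k1 k2 l1 l2 l3 l4 hrη (hA e) (hB e) ?_ ?_ ?_ ?_ ?_ hζη ?_ ?_
      hτζ le_rfl
    · intro x hx
      exact Hr0 _ _ (hx.trans_lt hrr)
    · intro x hx
      rw [θv x hx]
      rcases mem_uIcc.1 (hv e x) with h | h <;> rw [mem_uIcc]
      · left; constructor <;> linarith [h.1, h.2]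
      · right; constructor <;> linarith [h.1, h.2]
    · rw [θv _ left_mem_uIcc, vA]; ring
    · rw [θv _ right_mem_uIcc, vB]; ring
    · intro y hy
      rw [ec e (Finset.mem_univ _) _ ((coe_dist_le _ _ _).trans hy)]; ring
    · linarith [h5 e]
    · intro x y y' h
      refine Hω _ _ (lt_of_le_of_lt ?_ hτω)
      rw [Prod.dist_eq, Real.dist_eq, Real.dist_eq, sub_self, abs_zero]
      exact max_le hτ.le h
  intro k l hkl
  have hmz : (0 : ℤ) < m := by exact_mod_cast hm
  obtain ⟨x, hx, hy⟩ := hkl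
  have hy' := cellO_shift m (-(k.1 / m)) (-(k.2 / m)) _ _ hy
  rw [← hF] at hy'
  have ek : ∀ a : ℤ, a + m * -(a / m) = a % m := by
    intro a; have := Int.emod_add_mul_ediv a m; linarith
  have G := main ⟨((k.1 + m * -(k.1 / m), k.2 + m * -(k.2 / m)),
    (l.1 + m * -(k.1 / m), l.2 + m * -(k.2 / m))), by
      rw [ek, ek]; exact Int.emod_nonneg _ hmz.ne', by
      dsimp only; rw [ek]; exact Int.emod_lt_of_pos _ hmz, by
      dsimp only; rw [ek]; exact Int.emod_nonneg _ hmz.ne', by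
      dsimp only; rw [ek]; exact Int.emod_lt_of_pos _ hmz,
      _, cellO_shift m _ _ _ _ hx, hy'⟩
  have G' := G.translate hF pθ pc (k.1 / m) (k.2 / m)
  have e1 : ∀ a b : ℤ, a + m * -b + m * b = a := fun a b => by ring
  simp only [e1, Prod.mk.eta] at G'
  exact ⟨_, _, _, G'⟩

lemma core {m : ℕ} (hm : 0 < m) (F : ℝ × ℝ ≃ₜ ℝ × ℝ) (hF : Per m F) (hg : Gen F) :
    ∃ ψ : ℝ × ℝ ≃ₜ ℝ × ℝ, Per m ψ ∧ (∀ x, dist (ψ x) x ≤ 1) ∧ ∃ δ > 0,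
      ∀ H1 H2 : ℝ × ℝ ≃ₜ ℝ × ℝ, (∀ x, dist (H1 x) (F (ψ x)) < δ) →
        (∀ x, dist (H2 x) (F (ψ x)) < δ) → ∀ z (n : ℕ), ∃ z', dist z' z ≤ 1 ∧
          dist (H2^[n] z') (H1^[n] z) ≤ 1 := by
  obtain ⟨θ, c, η, τ, δ, hθ, hc, cθ, cc, pθ, pc, hδ, hG⟩ := data hm F hF
  set ψ := psi θ c η τ hθ hc cθ cc with hψ
  have per : Per m ψ := psi_per hθ hc cθ cc pθ pc
  have per' : Per m (fun x => F (ψ x)) := by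
    intro p i j
    dsimp only
    rw [per, hF]
  obtain ⟨δ', hδ', Hδ'⟩ := trans_local hm per' (F.continuous.comp ψ.continuous)
  refine ⟨ψ, per, fun x => cell_dist (psi_cell hθ hc cθ cc (mem_cell x)) (mem_cell x),
    min δ δ', lt_min hδ hδ', ?_⟩
  intro H1 H2 h1 h2 z n
  set o : ℕ → ℝ × ℝ := fun i => match i with
    | 0 => H1.symm z
    | i + 1 => H1^[i] z with ho
  have hstep : ∀ i, H1 (o i) = o (i + 1) := by
    intro i
    rcases i with _ | i
    · simp [ho]
    · simp only [ho]
      exact (Function.iterate_succ_apply' H1 i z).symm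
  set k : ℕ → ℤ × ℤ := fun i => (⌊(o i).1⌋, ⌊(o i).2⌋) with hk
  have hmem : ∀ i, o i ∈ cellC (k i) := fun i => mem_cell _
  have harr : ∀ i < n + 1, Arrow F (k i) (k (i + 1)) := by
    intro i _
    obtain ⟨x0, e1, e2⟩ := Hδ' (o i) (o (i + 1)) (by
      rw [← hstep]; exact (h1 _).trans_le (min_le_right _ _)) _ _ (hmem i) (hmem (i + 1))
    exact hg _ _ ⟨ψ x0, psi_cell hθ hc cθ cc e1, e2⟩
  obtain ⟨z', hz'⟩ := realize hθ hc cθ cc hG H2.continuous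
    (fun x => (h2 x).trans_le (min_le_left _ _)) n k harr
  exact ⟨z', cell_dist (hz' 0 (Nat.zero_le _)) (hmem 1), cell_dist (hz' n le_rfl) (hmem (n + 1))⟩

lemma cellC_eq (k : ℤ × ℤ) : cellC k = Icc (k.1 : ℝ) (k.1 + 1) ×ˢ Icc (k.2 : ℝ) (k.2 + 1) := by
  ext p; simp only [cellC, mem_ofPred_eq, mem_prod, mem_Icc, and_assoc]

lemma cellO_eq (k : ℤ × ℤ) : cellO k = Ioo (k.1 : ℝ) (k.1 + 1) ×ˢ Ioo (k.2 : ℝ) (k.2 + 1) := by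
  ext p; simp [cellO, and_assoc]

lemma cell_closure (k : ℤ × ℤ) : cellC k = closure (cellO k) := by
  rw [cellO_eq, cellC_eq, closure_prod_eq, closure_Ioo (by linarith), closure_Ioo (by linarith)]

lemma generic (F : ℝ × ℝ ≃ₜ ℝ × ℝ) {ε : ℝ} (hε : 0 < ε) :
    ∃ t : ℝ × ℝ, dist t 0 < ε ∧ Gen (F.trans (Homeomorph.addRight t)) := by
  set U : (ℤ × ℤ) × (ℤ × ℤ) → Set (ℝ × ℝ) := fun e =>
    {t | ∃ x ∈ cellO e.1, F x + t ∈ cellO e.2} with hU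
  have oU : ∀ e, IsOpen (U e) := by
    intro e
    have : U e = ⋃ x ∈ cellO e.1, (fun t => F x + t) ⁻¹' cellO e.2 := by
      ext t; simp [hU]
    rw [this]
    exact isOpen_biUnion fun x _ => (cellO_open _).preimage (by fun_prop)
  have hsub : ∀ e t, (∃ x ∈ cellC e.1, F x + t ∈ cellC e.2) → t ∈ closure (U e) := by
    rintro e t ⟨x, hx, hy⟩
    rw [cell_closure] at hx hy
    have : (x, F x + t) ∈ closure (cellO e.1 ×ˢ cellO e.2) := by
      rw [closure_prod_eq]; exact ⟨hx, hy⟩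
    have h2 := map_mem_closure (f := fun p : (ℝ × ℝ) × (ℝ × ℝ) => p.2 - F p.1)
      (t := U e) (by have := F.continuous; fun_prop) this (by
        rintro ⟨a, b⟩ ⟨ha, hb⟩
        exact ⟨a, ha, by simpa using hb⟩)
    simpa using h2
  have hd : Dense (⋂ e, (frontier (U e))ᶜ) := by
    refine dense_iInter_of_isOpen (fun e => isClosed_frontier.isOpen_compl) fun e => ?_
    rw [← interior_eq_empty_iff_dense_compl]
    rw [← frontier_compl]
    exact interior_frontier (oU e).isClosed_compl
  obtain ⟨t, ht, ht'⟩ := hd.inter_open_nonempty (ball 0 ε) isOpen_ball ⟨0, mem_ball_self hε⟩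
  refine ⟨t, ht, ?_⟩
  intro k l hkl
  have h1 := hsub (k, l) t hkl
  have h2 : t ∉ frontier (U (k, l)) := mem_iInter.1 ht' (k, l)
  rw [(oU _).frontier_eq] at h2
  by_contra h3
  exact h2 ⟨h1, h3⟩

def Equi (F : R2 → R2) : Prop := ∀ x : R2, ∀ w ∈ intLattice, F (x + w) = F x + w

lemma Equi.symm {F : R2 ≃ₜ R2} (h : Equi F) : Equi F.symm := by
  intro x w hw
  apply F.injective
  rw [h _ _ hw]
  simp

lemma R2.ext' {x y : R2} (h0 : x 0 = y 0) (h1 : x 1 = y 1) : x = y := by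
  ext i; fin_cases i
  · exact h0
  · exact h1

lemma R2.norm_le (x : R2) {r : ℝ} (h0 : |x 0| ≤ r) (h1 : |x 1| ≤ r) : ‖x‖ ≤ 2 * r := by
  have hr : 0 ≤ r := (abs_nonneg _).trans h0
  rw [EuclideanSpace.norm_eq, Fin.sum_univ_two]
  apply Real.sqrt_le_iff.2 ⟨by positivity, ?_⟩
  simp only [Real.norm_eq_abs]
  nlinarith [abs_nonneg (x 0), abs_nonneg (x 1)]

lemma R2.coord_le (x : R2) (i : Fin 2) : |x i| ≤ ‖x‖ := by
  have := PiLp.norm_apply_le x i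
  rwa [Real.norm_eq_abs] at this

lemma lat_mk (i j : ℤ) : (!₂[(i : ℝ), (j : ℝ)] : R2) ∈ intLattice := by
  intro a
  fin_cases a
  · exact ⟨i, rfl⟩
  · exact ⟨j, rfl⟩

lemma lat_sep {w : R2} (hw : w ∈ intLattice) (h : ‖w‖ < 1) : w = 0 := by
  ext i
  obtain ⟨n, hn⟩ := hw i
  have h1 : |(n : ℝ)| < 1 := by rw [← hn]; exact (R2.coord_le w i).trans_lt h
  rw [hn]
  have h2 : |n| < 1 := by exact_mod_cast h1
  rw [Int.abs_lt_one_iff] at h2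
  simp [h2]

lemma lat_reduce (x : R2) : ∃ w ∈ intLattice, ‖x + w‖ ≤ 2 := by
  refine ⟨_, lat_mk (-⌊x 0⌋) (-⌊x 1⌋), ?_⟩
  have h : ∀ t : ℝ, |t + ((-⌊t⌋ : ℤ) : ℝ)| ≤ 1 := by
    intro t
    have h1 := Int.floor_le t
    have h2 := Int.lt_floor_add_one t
    push_cast
    rw [abs_le]; constructor <;> linarith
  have := R2.norm_le (x + !₂[((-⌊x 0⌋ : ℤ) : ℝ), ((-⌊x 1⌋ : ℤ) : ℝ)]) (r := 1) (h (x 0)) (h (x 1))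
  linarith

lemma Equi.bdd {F G : R2 → R2} (hF : Equi F) (hG : Equi G) (cF : Continuous F)
    (cG : Continuous G) : BddAbove (range fun x => dist (F x) (G x)) := by
  obtain ⟨C, hC⟩ := (isCompact_closedBall (0 : R2) 2).bddAbove_image
    (f := fun x => dist (F x) (G x)) (by fun_prop)
  refine ⟨C, ?_⟩
  rintro _ ⟨x, rfl⟩
  obtain ⟨w, hw, hx⟩ := lat_reduce x
  have := hC ⟨x + w, by simpa using hx, rfl⟩
  dsimp only at this
  rwa [hF _ _ hw, hG _ _ hw, dist_add_right] at this

lemma Equi.lt_of_supDist {F G : R2 → R2} (hF : Equi F) (hG : Equi G) (cF : Continuous F)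
    (cG : Continuous G) {δ : ℝ} (h : supDist F G < δ) (x : R2) : dist (F x) (G x) < δ :=
  (le_ciSup (hF.bdd hG cF cG) x).trans_lt h

lemma Equi.unif {F : R2 → R2} (hF : Equi F) (cF : Continuous F) {ε : ℝ} (hε : 0 < ε) :
    ∃ δ > 0, ∀ x x', dist x x' < δ → dist (F x) (F x') < ε := by
  have := (isCompact_closedBall (0 : R2) 2).uniformContinuousAt_of_continuousAt F
    (fun a _ => cF.continuousAt) (Metric.dist_mem_uniformity hε)
  obtain ⟨δ, hδ, h⟩ := Metric.mem_uniformity_dist.1 this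
  refine ⟨δ, hδ, fun x x' hx => ?_⟩
  obtain ⟨w, hw, hx2⟩ := lat_reduce x
  have h1 := h (a := x + w) (b := x' + w) (by rwa [dist_add_right]) (by simpa using hx2)
  simpa only [mem_ofPred_eq, hF _ _ hw, dist_add_right] using h1

lemma rot_sub {H1 H2 : R2 ≃ₜ R2} {C : ℝ} (h : ∀ z (n : ℕ), ∃ z', dist z' z ≤ C ∧
    dist (H2^[n] z') (H1^[n] z) ≤ C) : rotSet H1 ⊆ rotSet H2 := by
  rintro v ⟨z, n, hn, hv⟩
  choose z' h1 h2 using fun k => h (z k) (n k)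
  refine ⟨z', n, hn, ?_⟩
  have hlim : Tendsto (fun k => (n k : ℝ)⁻¹ • ((H2^[n k] (z' k) - H1^[n k] (z k)) - (z' k - z k)))
      atTop (𝓝 0) := by
    apply squeeze_zero_norm (a := fun k => (n k : ℝ)⁻¹ * (2 * C))
    · intro k
      rw [norm_smul, Real.norm_eq_abs, abs_of_nonneg (by positivity)]
      refine mul_le_mul_of_nonneg_left ?_ (by positivity)
      refine (norm_sub_le _ _).trans ?_
      rw [← dist_eq_norm, ← dist_eq_norm]
      linarith [h1 k, h2 k]
    · have := (tendsto_inv_atTop_zero.comp (tendsto_natCast_atTop_atTop.comp hn)).mul_const (2 * C)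
      simpa using this
  have := hv.add hlim
  rw [add_zero] at this
  refine this.congr fun k => ?_
  rw [← smul_add]
  congr 1
  abel

def Phi (m : ℝ) (hm : m ≠ 0) : R2 ≃ₜ ℝ × ℝ where
  toFun x := (m * x 0, m * x 1)
  invFun p := !₂[p.1 / m, p.2 / m]
  left_inv x := by
    apply R2.ext'
    · simp [hm]
    · simp [hm]
  right_inv p := by
    ext
    · simp; field_simp
    · simp; field_simp
  continuous_toFun := by fun_prop
  continuous_invFun := by fun_prop

lemma Phi_dist {m : ℝ} (hm : m ≠ 0) (h0 : 0 < m) (x y : R2) :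
    dist (Phi m hm x) (Phi m hm y) ≤ m * dist x y := by
  rw [Prod.dist_eq, dist_eq_norm x y]
  refine max_le ?_ ?_
  · have := R2.coord_le (x - y) 0
    change |m * x 0 - m * y 0| ≤ _
    rw [← mul_sub, abs_mul, abs_of_pos h0]
    exact mul_le_mul_of_nonneg_left this h0.le
  · have := R2.coord_le (x - y) 1
    change |m * x 1 - m * y 1| ≤ _
    rw [← mul_sub, abs_mul, abs_of_pos h0]
    exact mul_le_mul_of_nonneg_left this h0.le

lemma Phi_symm_dist {m : ℝ} (hm : m ≠ 0) (h0 : 0 < m) (p q : ℝ × ℝ) :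
    dist ((Phi m hm).symm p) ((Phi m hm).symm q) ≤ 2 * (dist p q / m) := by
  rw [dist_eq_norm]
  have := dist_le_iff' (le_refl (dist p q))
  refine R2.norm_le _ ?_ ?_
  · change |p.1 / m - q.1 / m| ≤ _
    rw [← sub_div, abs_div, abs_of_pos h0]
    gcongr; exact this.1
  · change |p.2 / m - q.2 / m| ≤ _
    rw [← sub_div, abs_div, abs_of_pos h0]
    gcongr; exact this.2

lemma Phi_symm_shift {m : ℝ} (hm : m ≠ 0) (p : ℝ × ℝ) (i j : ℤ) :
    (Phi m hm).symm (p.1 + m * i, p.2 + m * j) = (Phi m hm).symm p + !₂[(i : ℝ), (j : ℝ)] := by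
  apply R2.ext'
  · change (p.1 + m * i) / m = p.1 / m + i
    field_simp
  · change (p.2 + m * j) / m = p.2 / m + j
    field_simp

lemma Phi_shift {m : ℝ} (hm : m ≠ 0) (x : R2) (i j : ℤ) :
    Phi m hm (x + !₂[(i : ℝ), (j : ℝ)]) = ((Phi m hm x).1 + m * i, (Phi m hm x).2 + m * j) := by
  apply (Phi m hm).symm.injective
  rw [Phi_symm_shift]
  simp

def conj (Φ : R2 ≃ₜ ℝ × ℝ) (F : R2 ≃ₜ R2) : ℝ × ℝ ≃ₜ ℝ × ℝ := Φ.symm.trans (F.trans Φ)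

lemma conj_apply (Φ : R2 ≃ₜ ℝ × ℝ) (F : R2 ≃ₜ R2) (p : ℝ × ℝ) :
    conj Φ F p = Φ (F (Φ.symm p)) := rfl

lemma conj_iter (Φ : R2 ≃ₜ ℝ × ℝ) (F : R2 ≃ₜ R2) (n : ℕ) (p : ℝ × ℝ) :
    F^[n] (Φ.symm p) = Φ.symm ((conj Φ F)^[n] p) := by
  have : Function.Semiconj Φ.symm (conj Φ F) F := fun p => by simp [conj_apply]
  exact ((this.iterate_right n) p).symm

lemma dense_plane (F : R2 ≃ₜ R2) (hF : Equi F) {ε : ℝ} (hε : 0 < ε) :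
    ∃ G : R2 ≃ₜ R2, Equi G ∧ (∀ x, dist (F x) (G x) ≤ ε) ∧ ∃ δ > 0, ∀ H : R2 ≃ₜ R2,
      (∀ x, dist (G x) (H x) < δ) → rotSet H = rotSet G := by
  obtain ⟨ω, hω, Hω⟩ := hF.unif F.continuous (half_pos hε)
  obtain ⟨m, hmω⟩ := exists_nat_gt (2 / ω)
  have hm0 : (0 : ℝ) < m := lt_trans (by positivity) hmω
  have hmn : 0 < m := by exact_mod_cast hm0
  have hmω' : 2 * (1 / (m : ℝ)) < ω := by
    rw [div_lt_iff₀ hω] at hmω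
    rw [mul_one_div, div_lt_iff₀ hm0]; linarith
  set Φ := Phi (m : ℝ) hm0.ne' with hΦ
  have per : Per m (conj Φ F) := by
    intro p i j
    rw [conj_apply, hΦ, Phi_symm_shift, hF _ _ (lat_mk i j), Phi_shift]; rfl
  obtain ⟨t, ht, hgen⟩ := generic (conj Φ F) (ε := m * (ε / 4)) (by positivity)
  have per' : Per m ((conj Φ F).trans (Homeomorph.addRight t)) := by
    intro p i j
    change conj Φ F (p.1 + m * i, p.2 + m * j) + t = _
    rw [per]
    change _ = (((conj Φ F p) + t).1 + m * i, ((conj Φ F p) + t).2 + m * j)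
    ext <;> simp <;> ring
  obtain ⟨ψ, pψ, dψ, δ, hδ, hsh⟩ := core hmn _ per' hgen
  set Gh := ψ.trans ((conj Φ F).trans (Homeomorph.addRight t)) with hGh
  set G : R2 ≃ₜ R2 := Φ.trans (Gh.trans Φ.symm) with hG
  have hGap : ∀ x, G x = Φ.symm (conj Φ F (ψ (Φ x)) + t) := fun x => rfl
  have shadow : ∀ H1 H2 : R2 ≃ₜ R2, (∀ x, dist (G x) (H1 x) < δ / m) →
      (∀ x, dist (G x) (H2 x) < δ / m) → rotSet H1 ⊆ rotSet H2 := by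
    intro H1 H2 h1 h2
    have key : ∀ H : R2 ≃ₜ R2, (∀ x, dist (G x) (H x) < δ / m) →
        ∀ p, dist (conj Φ H p) (Gh p) < δ := by
      intro H hH p
      have e1 := hH (Φ.symm p)
      rw [lt_div_iff₀ hm0] at e1
      have e2 := Phi_dist hm0.ne' hm0 (H (Φ.symm p)) (G (Φ.symm p))
      rw [dist_comm (H _)] at e2
      have e3 : Φ (G (Φ.symm p)) = Gh p := by simp [hG]
      rw [← hΦ, e3] at e2
      rw [conj_apply]
      linarith
    apply rot_sub (C := 2 * (1 / m))
    intro z n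
    obtain ⟨z', hz1, hz2⟩ := hsh (conj Φ H1) (conj Φ H2) (key _ h1) (key _ h2) (Φ z) n
    refine ⟨Φ.symm z', ?_, ?_⟩
    · have := Phi_symm_dist hm0.ne' hm0 z' (Φ z)
      rw [← hΦ, Φ.symm_apply_apply] at this
      refine this.trans ?_
      gcongr
    · have := Phi_symm_dist hm0.ne' hm0 ((conj Φ H2)^[n] z') ((conj Φ H1)^[n] (Φ z))
      rw [← hΦ, ← conj_iter, ← conj_iter, Φ.symm_apply_apply] at this
      refine this.trans ?_
      gcongr
  have hδm : 0 < δ / m := by positivity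
  refine ⟨G, ?_, ?_, δ / m, hδm, fun H hH => ?_⟩
  · intro x w hw
    obtain ⟨i, hi⟩ := hw 0
    obtain ⟨j, hj⟩ := hw 1
    obtain rfl : w = !₂[(i : ℝ), (j : ℝ)] := R2.ext' hi hj
    have : Per m Gh := by
      intro p a b
      change ((conj Φ F).trans (Homeomorph.addRight t)) (ψ _) = _
      rw [pψ, per']; rfl
    change Φ.symm (Gh (Φ (x + !₂[(i : ℝ), (j : ℝ)]))) = Φ.symm (Gh (Φ x)) + _
    rw [hΦ, Phi_shift, ← hΦ, this, hΦ, Phi_symm_shift]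
  · intro x
    have e1 : dist (F x) (F (Φ.symm (ψ (Φ x)))) < ε / 2 := by
      apply Hω
      have := Phi_symm_dist hm0.ne' hm0 (Φ x) (ψ (Φ x))
      rw [← hΦ, Φ.symm_apply_apply] at this
      refine lt_of_le_of_lt (this.trans ?_) hmω'
      gcongr
      rw [dist_comm]; exact dψ _
    have e2 : dist (F (Φ.symm (ψ (Φ x)))) (G x) ≤ ε / 2 := by
      have := Phi_symm_dist hm0.ne' hm0 (conj Φ F (ψ (Φ x))) (conj Φ F (ψ (Φ x)) + t)
      rw [← hΦ, ← hGap] at this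
      rw [conj_apply, Φ.symm_apply_apply] at this
      refine this.trans ?_
      have e3 : dist (Φ (F (Φ.symm (ψ (Φ x))))) (Φ (F (Φ.symm (ψ (Φ x)))) + t) = dist t 0 := by
        rw [dist_self_add_right, dist_zero_right]
      rw [e3]
      have : dist t 0 / m ≤ ε / 4 := by rw [div_le_iff₀ hm0]; linarith
      linarith
    have := dist_triangle (F x) (F (Φ.symm (ψ (Φ x)))) (G x)
    linarith
  · exact Subset.antisymm (shadow H G hH (fun x => by simpa using hδm))
      (shadow G H (fun x => by simpa using hδm) hH)

lemma pr_eq {x y : R2} : pr x = pr y ↔ ∃ w ∈ intLattice, y = x + w := by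
  constructor
  · intro h
    refine ⟨-x + y, (QuotientAddGroup.eq (s := intLattice)).1 h, by abel⟩
  · rintro ⟨w, hw, rfl⟩
    refine (QuotientAddGroup.eq (s := intLattice)).2 ?_
    simpa using hw

lemma pr_surj : Function.Surjective pr := QuotientAddGroup.mk_surjective

lemma pr_dist_le (x y : R2) : dist (pr x) (pr y) ≤ dist x y := by
  rw [dist_eq_norm, dist_eq_norm]
  exact QuotientAddGroup.norm_mk_le_norm (S := intLattice) (m := x - y)

lemma pr_dist_lt {x y : R2} {r : ℝ} (h : dist (pr x) (pr y) < r) :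
    ∃ w ∈ intLattice, ‖x - y + w‖ < r := by
  rw [dist_eq_norm] at h
  obtain ⟨u, hu, hur⟩ := QuotientAddGroup.norm_lt_iff.1 h
  obtain ⟨w, hw, e⟩ := pr_eq.1 (show pr (x - y) = pr u from hu.symm)
  exact ⟨w, hw, e ▸ hur⟩

lemma T2_bdd (f g : T2 ≃ₜ T2) : BddAbove (range fun x => dist (f x) (g x)) := by
  refine ⟨2, ?_⟩
  rintro _ ⟨x, rfl⟩
  obtain ⟨a, ha⟩ := pr_surj (f x)
  obtain ⟨b, hb⟩ := pr_surj (g x)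
  obtain ⟨w, hw, h⟩ := lat_reduce (a - b)
  dsimp only
  rw [← ha, ← hb, show pr a = pr (a + w) from pr_eq.2 ⟨w, hw, rfl⟩]
  refine (pr_dist_le _ _).trans ?_
  rw [dist_eq_norm, show a + w - b = a - b + w by abel]
  exact h

def tMap2 (G : R2 → R2) (h : Equi G) : T2 → T2 :=
  Quotient.lift (fun x => pr (G x)) (by
    intro a b hab
    obtain ⟨w, hw, e⟩ := pr_eq.1 (show pr a = pr b from Quotient.sound hab)
    exact pr_eq.2 ⟨w, hw, by rw [e, h _ _ hw]⟩)

lemma tMap2_pr (G : R2 → R2) (h : Equi G) (x : R2) : tMap2 G h (pr x) = pr (G x) := rfl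

lemma tMap2_cont (G : R2 → R2) (h : Equi G) (c : Continuous G) : Continuous (tMap2 G h) :=
  (QuotientAddGroup.isQuotientMap_mk intLattice).continuous_iff.2
    ((QuotientAddGroup.continuous_mk (N := intLattice)).comp c)

def torusHomeo (G : R2 ≃ₜ R2) (h : Equi G) : T2 ≃ₜ T2 where
  toFun := tMap2 G h
  invFun := tMap2 G.symm h.symm
  left_inv x := by
    obtain ⟨y, rfl⟩ := pr_surj x
    rw [tMap2_pr, tMap2_pr, G.symm_apply_apply]
  right_inv x := by
    obtain ⟨y, rfl⟩ := pr_surj x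
    rw [tMap2_pr, tMap2_pr, G.apply_symm_apply]
  continuous_toFun := tMap2_cont _ _ G.continuous
  continuous_invFun := tMap2_cont _ _ G.symm.continuous

lemma torusHomeo_lift (G : R2 ≃ₜ R2) (h : Equi G) : IsLift (torusHomeo G h) G :=
  ⟨fun _ => rfl, h⟩

lemma dense_part : DenseIn Homeo0 {f | HasStableRotSet Homeo0 f} := by
  rintro f ⟨F, hF⟩ ε hε
  obtain ⟨G, hG, hd, δ, hδ, hs⟩ := dense_plane F hF.equivariant (half_pos hε)
  have hl := torusHomeo_lift G hG
  refine ⟨torusHomeo G hG, ⟨⟨G, hl, δ, hδ, ?_⟩, ⟨G, hl⟩⟩, ?_⟩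
  · intro h _ H hH hlt
    exact hs H (Equi.lt_of_supDist hG hH.equivariant G.continuous H.continuous hlt)
  · refine lt_of_le_of_lt (ciSup_le fun x => ?_) (half_lt_self hε)
    obtain ⟨y, rfl⟩ := pr_surj x
    rw [← hF.proj, ← hl.proj]
    exact (pr_dist_le _ _).trans (hd y)

lemma open_part : OpenIn Homeo0 {f | HasStableRotSet Homeo0 f} := by
  rintro f ⟨⟨F, hF, δ, hδ, hs⟩, -⟩
  refine ⟨min (δ / 4) (1 / 8), by positivity, ?_⟩
  rintro g ⟨G', hG'⟩ hfg
  have h1 : ∀ x, ∃ w ∈ intLattice, ‖F x - G' x + w‖ < min (δ / 4) (1 / 8) := by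
    intro x
    apply pr_dist_lt
    rw [hF.proj, hG'.proj]
    exact (le_ciSup (T2_bdd f g) (pr x)).trans_lt hfg
  obtain ⟨w0, hw0, h0⟩ := h1 0
  have h2 : ∀ x, ‖F x - G' x + w0‖ < 1 / 4 → ‖F x - G' x + w0‖ < min (δ / 4) (1 / 8) := by
    intro x hx
    obtain ⟨w, hw, h⟩ := h1 x
    have h3 : ‖w0 - w‖ < 1 := by
      have := norm_sub_le (F x - G' x + w0) (F x - G' x + w)
      rw [add_sub_add_left_eq_sub] at this
      have := h.trans_le (min_le_right _ _)
      linarith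
    have h4 := lat_sep (intLattice.sub_mem hw0 hw) h3
    rw [sub_eq_zero.1 h4]
    exact h
  have cF := F.continuous
  have cG := G'.continuous
  have hclopen : IsClopen {x | ‖F x - G' x + w0‖ < 1 / 4} := by
    refine ⟨?_, isOpen_lt (by fun_prop) continuous_const⟩
    have : {x | ‖F x - G' x + w0‖ < 1 / 4} = {x | ‖F x - G' x + w0‖ ≤ 1 / 8} := by
      ext x
      constructor
      · intro hx
        exact ((h2 x hx).trans_le (min_le_right _ _)).le
      · intro hx
        exact lt_of_le_of_lt (show ‖F x - G' x + w0‖ ≤ 1 / 8 from hx) (by norm_num : (1 / 8 : ℝ) < 1 / 4)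
    rw [this]
    exact isClosed_le (by fun_prop) continuous_const
  have huniv := hclopen.eq_univ ⟨0, (h0.trans_le (min_le_right _ _)).trans (by norm_num)⟩
  have h3 : ∀ x, ‖F x - G' x + w0‖ < min (δ / 4) (1 / 8) := by
    intro x
    refine h2 x ?_
    have : x ∈ {x | ‖F x - G' x + w0‖ < 1 / 4} := by rw [huniv]; trivial
    exact this
  set G : R2 ≃ₜ R2 := G'.trans (Homeomorph.addRight (-w0)) with hGdef
  have hGx : ∀ x, G x = G' x + -w0 := fun x => rfl
  have hG : IsLift g G := by
    refine ⟨fun x => ?_, fun x w hw => ?_⟩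
    · rw [← hG'.proj, hGx]
      exact (pr_eq.2 ⟨-w0, intLattice.neg_mem hw0, rfl⟩).symm
    · rw [hGx, hGx, hG'.equivariant _ _ hw]; abel
  have hFG : ∀ x, dist (F x) (G x) ≤ δ / 4 := by
    intro x
    rw [dist_eq_norm, hGx, show F x - (G' x + -w0) = F x - G' x + w0 by abel]
    exact ((h3 x).trans_le (min_le_left _ _)).le
  have hrot : rotSet G = rotSet F :=
    hs g ⟨G', hG'⟩ G hG (lt_of_le_of_lt (ciSup_le hFG) (by linarith))
  refine ⟨G, hG, δ / 2, by positivity, ?_⟩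
  intro h hh H hH hlt
  rw [hrot]
  refine hs h hh H hH (lt_of_le_of_lt (b := δ / 4 + δ / 2) (ciSup_le fun x => ?_) (by linarith))
  have e1 := Equi.lt_of_supDist hG.equivariant hH.equivariant G.continuous H.continuous hlt x
  have e2 := dist_triangle (F x) (G x) (H x)
  linarith [hFG x]

/-- The set of homeomorphisms `f ∈ Homeo₀(T²)` whose rotation set is
stable under `C⁰`-small perturbations within `Homeo₀(T²)` is open and dense in
`Homeo₀(T²)` for the uniform `C⁰` topology. -/
theorem stable_rotation_set_open_and_dense_in_Homeo0 :
    OpenIn Homeo0 {f | HasStableRotSet Homeo0 f} ∧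
    DenseIn Homeo0 {f | HasStableRotSet Homeo0 f} :=
  ⟨open_part, dense_part⟩
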